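/- arXiv:2504.07142 — 14 statements merged into one kernel-verified Lean document; each statement's English description precedes it below -/
import Mathlib

section
/- Let λ > 0 and β > 1 be real numbers. Then the equation e^{-λx} = 1 - x^β has exactly one solution x in the open interval (0, 1); that is, there exists a unique x with 0 < x < 1 such that e^{-λx} = 1 - x^β. -/
open Real

/-- A strictly convex function vanishing at `0` has at most one further zero on the right. -/
lemma StrictConvexOn.eq_of_pos_zeros {f : ℝ → ℝ} (hf : StrictConvexOn ℝ (Set.Ici 0) f)
    (h0 : f 0 = 0) {x y : ℝ} (hx : 0 < x) (hy : 0 < y) (hfx : f x = 0) (hfy : f y = 0) :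
    x = y := by
  have key : ∀ a b : ℝ, 0 < a → f a = 0 → f b = 0 → ¬ a < b := by
    intro a b ha hfa hfb hab
    have h := hf.slope_strict_mono_adjacent (x := 0) (Set.mem_Ici.2 le_rfl)
      (Set.mem_Ici.2 (ha.trans hab).le) ha hab
    simp [h0, hfa, hfb] at h
  exact le_antisymm (not_lt.1 (key y x hy hfy hfx)) (not_lt.1 (key x y hx hfx hfy))

/-- A function with negative derivative at a point takes smaller values just to the right. -/
lemma HasDerivAt.eventually_lt_right {f : ℝ → ℝ} {f' a : ℝ} (hf : HasDerivAt f f' a)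
    (hf' : f' < 0) : ∀ᶠ x in nhdsWithin a (Set.Ioi a), f x < f a := by
  have h := (hasDerivAt_iff_tendsto_slope.1 hf).mono_left
    (nhdsWithin_mono a fun x (hx : a < x) => hx.ne')
  filter_upwards [h.eventually_lt_const hf', self_mem_nhdsWithin] with x hx hax
  rw [slope_def_field, div_neg_iff] at hx
  have : 0 < x - a := sub_pos.2 hax
  rcases hx with hx | hx <;> linarith [hx.1, hx.2]

lemma strictConvexOn_exp_neg_add_rpow (lam : ℝ) {beta : ℝ} (hbeta : 1 < beta) :
    StrictConvexOn ℝ (Set.Ici 0) fun x : ℝ => exp (-(lam * x)) + x ^ beta := by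
  have h : ConvexOn ℝ (Set.Ici 0) fun x : ℝ => exp (-(lam * x)) := by
    have := (convexOn_exp.comp_linearMap (LinearMap.mulLeft ℝ (-lam))).subset
      (Set.subset_univ (Set.Ici 0)) (convex_Ici 0)
    simpa [Function.comp_def] using this
  exact h.add_strictConvexOn (strictConvexOn_rpow hbeta)

/-- For real `λ > 0` and `β > 1`, the equation `e^{-λx} = 1 - x^β` has exactly one
solution in the open interval `(0, 1)`. -/
theorem stmt_0 (lam beta : ℝ) (hlam : 0 < lam) (hbeta : 1 < beta) :
    ∃! x : ℝ, x ∈ Set.Ioo (0 : ℝ) 1 ∧ Real.exp (-(lam * x)) = 1 - x ^ beta := by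
  have hb : 0 < beta := by linarith
  set f : ℝ → ℝ := fun x => exp (-(lam * x)) + x ^ beta + (-1) with hf
  have hconv : StrictConvexOn ℝ (Set.Ici 0) f :=
    (strictConvexOn_exp_neg_add_rpow lam hbeta).add_const (-1)
  have h0 : f 0 = 0 := by simp [hf, Real.zero_rpow hb.ne']
  have h1 : 0 < f 1 := by simp [hf, exp_pos]
  have hiff : ∀ x, exp (-(lam * x)) = 1 - x ^ beta ↔ f x = 0 := fun x => by
    simp only [hf]; constructor <;> intro h <;> linarith
  have hderiv : HasDerivAt f (-lam) 0 := by
    have hexp : HasDerivAt (fun x : ℝ => exp (-(lam * x))) (-lam) 0 := by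
      simpa using (((hasDerivAt_id (0 : ℝ)).const_mul lam).neg).exp
    have hpow : HasDerivAt (fun x : ℝ => x ^ beta) 0 0 := by
      simpa [Real.zero_rpow (sub_pos.2 hbeta).ne'] using
        Real.hasDerivAt_rpow_const (x := 0) (p := beta) (Or.inr hbeta.le)
    have hsum := (hexp.add hpow).add_const (-1)
    rw [add_zero] at hsum
    exact hsum
  obtain ⟨a, hfa, ha0, ha1⟩ := ((hderiv.eventually_lt_right (neg_lt_zero.2 hlam)).and
    (Ioo_mem_nhdsGT (zero_lt_one' ℝ))).exists
  rw [h0] at hfa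
  have hcont : Continuous f := by
    have := Real.continuous_rpow_const hb.le
    fun_prop
  obtain ⟨x, hx, hfx⟩ := intermediate_value_Ioo ha1.le hcont.continuousOn ⟨hfa, h1⟩
  refine ⟨x, ⟨⟨ha0.trans hx.1, hx.2⟩, (hiff x).2 hfx⟩, fun y hy => ?_⟩
  exact hconv.eq_of_pos_zeros h0 hy.1.1 (ha0.trans hx.1) ((hiff y).1 hy.2) hfx
end

section
/- Let β > 1. For every x > 0 there exists a unique y ∈ (0,1) with y^β = 1 - e^{-x·y}; denote it y_β(x). Then the function y_β : (0,∞) → (0,1) is strictly monotonically increasing, differentiable on (0,∞), tends to 0 as x → 0+, and tends to 1 as x → ∞. In particular, y_β extends to the cumulative distribution function of a non-negative absolutely continuous random variable. -/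
open Real Filter MeasureTheory

/-- A function on `(0,∞)` with nonnegative derivative, tending to `0` at `0⁺` and to `1` at `∞`,
is the cdf of an absolutely continuous probability measure carried by `[0,∞)`. -/
lemma exists_absolutelyContinuous_measure_of_hasDerivAt {F f : ℝ → ℝ}
    (hF : ∀ x, 0 < x → HasDerivAt F (f x) x) (hf : ∀ x, 0 < x → 0 ≤ f x)
    (h0 : Tendsto F (nhdsWithin 0 (Set.Ioi 0)) (nhds 0)) (h1 : Tendsto F atTop (nhds 1)) :
    ∃ μ : Measure ℝ, IsProbabilityMeasure μ ∧ μ ≪ volume ∧ μ (Set.Iio 0) = 0 ∧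
      ∀ x : ℝ, 0 < x → (μ (Set.Iic x)).toReal = F x := by
  set G : ℝ → ℝ := Function.update F 0 0 with hG
  have hGF : ∀ x, 0 < x → G x = F x := fun x hx => Function.update_of_ne hx.ne' _ _
  have hG0 : G 0 = 0 := Function.update_self _ _ _
  have hGd : ∀ x ∈ Set.Ioi (0 : ℝ), HasDerivAt G (f x) x := fun x hx =>
    (hF x hx).congr_of_eventuallyEq (by
      filter_upwards [Ioi_mem_nhds hx] with z hz using hGF z hz)
  have hGc : ContinuousWithinAt G (Set.Ici 0) 0 := by
    rw [hG, continuousWithinAt_update_same, Set.Ici_sdiff_left]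
    exact h0
  have hG1 : Tendsto G atTop (nhds 1) := h1.congr' (by
    filter_upwards [eventually_gt_atTop 0] with z hz using (hGF z hz).symm)
  have hint : IntegrableOn f (Set.Ioi 0) :=
    integrableOn_Ioi_deriv_of_nonneg hGc hGd hf hG1
  have htail : ∀ x, 0 ≤ x → ∫⁻ t in Set.Ioi x, ENNReal.ofReal (f t) = ENNReal.ofReal (1 - G x) := by
    intro x hx
    have hsub : Set.Ioi x ⊆ Set.Ioi 0 := Set.Ioi_subset_Ioi hx
    rw [← ofReal_integral_eq_lintegral_ofReal (hint.mono_set hsub)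
      ((ae_restrict_iff' measurableSet_Ioi).2 (ae_of_all _ fun t ht => hf t (hsub ht)))]
    congr 1
    refine integral_Ioi_of_hasDerivAt_of_nonneg ?_ (fun t ht => hGd t (hsub ht))
      (fun t ht => hf t (hsub ht)) hG1
    rcases hx.eq_or_lt with rfl | hx
    · exact hGc
    · exact (hGd x hx).continuousAt.continuousWithinAt
  set μ : Measure ℝ := (volume.restrict (Set.Ioi 0)).withDensity fun t => ENNReal.ofReal (f t)
    with hμ
  have hprob : IsProbabilityMeasure μ := ⟨by
    rw [hμ, withDensity_apply _ MeasurableSet.univ, Measure.restrict_univ, htail 0 le_rfl, hG0]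
    simp⟩
  have hac : μ ≪ volume.restrict (Set.Ioi 0) := withDensity_absolutelyContinuous _ _
  refine ⟨μ, hprob, hac.trans Measure.absolutelyContinuous_restrict, hac ?_, fun x hx => ?_⟩
  · rw [Measure.restrict_apply measurableSet_Iio]
    convert measure_empty (μ := (volume : Measure ℝ))
    ext z
    simpa using fun h : z < 0 => h.le
  · have hIoi : (μ (Set.Ioi x)) = ENNReal.ofReal (1 - G x) := by
      rw [hμ, withDensity_apply _ measurableSet_Ioi, Measure.restrict_restrict measurableSet_Ioi,
        Set.inter_eq_left.2 (Set.Ioi_subset_Ioi hx.le), htail x hx.le]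
    have hmono : MonotoneOn G (Set.Ici x) := by
      refine monotoneOn_of_deriv_nonneg (convex_Ici x)
        (fun t ht => (hGd t (hx.trans_le ht)).continuousAt.continuousWithinAt)
        (fun t ht => ?_) (fun t ht => ?_)
      all_goals rw [interior_Ici] at ht
      · exact (hGd t (hx.trans ht)).differentiableAt.differentiableWithinAt
      · rw [(hGd t (hx.trans ht)).deriv]
        exact hf t (hx.trans ht)
    have hle : G x ≤ 1 := ge_of_tendsto hG1 (by
      filter_upwards [eventually_ge_atTop x] with z hz using hmono Set.self_mem_Ici hz hz)
    have hc := probReal_compl_eq_one_sub (μ := μ) (measurableSet_Ioi (a := x))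
    rw [Set.compl_Ioi] at hc
    change μ.real (Set.Iic x) = _
    rw [hc, Measure.real, hIoi, ENNReal.toReal_ofReal (by linarith), ← hGF x hx]
    ring

/-- The inverse `x_β(y) = -log(1 - y^β)/y` of the generalized Lambert function. -/
noncomputable def lambertInv (b y : ℝ) : ℝ := -Real.log (1 - y ^ b) / y

section lambertInv

variable {b y : ℝ}

lemma one_sub_rpow_mem_Ioo (hb : 0 < b) (hy : y ∈ Set.Ioo (0 : ℝ) 1) :
    1 - y ^ b ∈ Set.Ioo (0 : ℝ) 1 :=
  ⟨sub_pos.2 (Real.rpow_lt_one hy.1.le hy.2 hb), sub_lt_self _ (Real.rpow_pos_of_pos hy.1 b)⟩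

lemma lambertInv_pos (hb : 0 < b) (hy : y ∈ Set.Ioo (0 : ℝ) 1) : 0 < lambertInv b y := by
  have h := one_sub_rpow_mem_Ioo hb hy
  exact div_pos (neg_pos.2 (Real.log_neg h.1 h.2)) hy.1

lemma rpow_eq_one_sub_exp_iff (hb : 0 < b) (hy : y ∈ Set.Ioo (0 : ℝ) 1) {x : ℝ} :
    y ^ b = 1 - Real.exp (-(x * y)) ↔ lambertInv b y = x := by
  have h := one_sub_rpow_mem_Ioo hb hy
  rw [lambertInv, div_eq_iff hy.1.ne', neg_eq_iff_eq_neg]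
  constructor
  · intro e
    rw [e, sub_sub_cancel, Real.log_exp]
  · intro e
    rw [← e, Real.exp_log h.1]
    ring

lemma exists_pos_hasDerivAt_lambertInv (hb : 1 < b) (hy : y ∈ Set.Ioo (0 : ℝ) 1) :
    ∃ d, 0 < d ∧ HasDerivAt (lambertInv b) d y := by
  have h := one_sub_rpow_mem_Ioo (zero_lt_one.trans hb) hy
  have hd := ((((Real.hasDerivAt_rpow_const (p := b) (Or.inl hy.1.ne')).const_sub 1).log
    h.1.ne').neg).div (hasDerivAt_id y) hy.1.ne'
  refine ⟨_, ?_, hd⟩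
  refine div_pos ?_ (pow_pos hy.1 2)
  have hlog := Real.one_sub_inv_le_log_of_pos h.1
  have hrp : y ^ (b - 1) * y = y ^ b := by
    rw [← Real.rpow_add_one hy.1.ne', sub_add_cancel]
  have hyb : 0 < y ^ b := Real.rpow_pos_of_pos hy.1 b
  have hkey : -(-(b * y ^ (b - 1)) / (1 - y ^ b)) * y = b * (y ^ b / (1 - y ^ b)) := by
    rw [← hrp]
    ring
  have hinv : 1 - (1 - y ^ b)⁻¹ = -(y ^ b / (1 - y ^ b)) := by
    have := h.1.ne'
    field_simp
    ring
  have hq : 0 < y ^ b / (1 - y ^ b) := div_pos hyb h.1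
  simp only [id, mul_one, Pi.neg_apply]
  rw [hkey]
  nlinarith

lemma continuousOn_lambertInv (hb : 1 < b) : ContinuousOn (lambertInv b) (Set.Ioo 0 1) :=
  fun _ hy =>
    (exists_pos_hasDerivAt_lambertInv hb hy).choose_spec.2.continuousAt.continuousWithinAt

lemma strictMonoOn_lambertInv (hb : 1 < b) : StrictMonoOn (lambertInv b) (Set.Ioo 0 1) := by
  refine strictMonoOn_of_deriv_pos (convex_Ioo 0 1) (continuousOn_lambertInv hb) fun y hy => ?_
  rw [interior_Ioo] at hy
  obtain ⟨d, hd, h⟩ := exists_pos_hasDerivAt_lambertInv hb hy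
  rwa [h.deriv]

lemma tendsto_rpow_one_left (b : ℝ) : Tendsto (fun y : ℝ => y ^ b) (nhds 1) (nhds 1) := by
  simpa using (Real.continuousAt_rpow_const 1 b (Or.inl one_ne_zero)).tendsto

lemma tendsto_lambertInv_zero (hb : 1 < b) :
    Tendsto (lambertInv b) (nhdsWithin 0 (Set.Ioi 0)) (nhds 0) := by
  have hlim : ∀ p : ℝ, 0 < p → Tendsto (fun y : ℝ => y ^ p) (nhdsWithin 0 (Set.Ioi 0)) (nhds 0) :=
    fun p hp => by
      simpa [Real.zero_rpow hp.ne'] using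
        (Real.continuousAt_rpow_const 0 p (Or.inr hp.le)).tendsto.mono_left nhdsWithin_le_nhds
  have hup : Tendsto (fun y : ℝ => y ^ (b - 1) / (1 - y ^ b)) (nhdsWithin 0 (Set.Ioi 0))
      (nhds 0) := by
    have h := (hlim (b - 1) (by linarith)).div ((hlim b (by linarith)).const_sub 1) (by simp)
    rwa [zero_div] at h
  have hmem : Set.Ioo (0 : ℝ) 1 ∈ nhdsWithin (0 : ℝ) (Set.Ioi 0) :=
    Ioo_mem_nhdsGT zero_lt_one
  refine tendsto_of_tendsto_of_tendsto_of_le_of_le' tendsto_const_nhds hup ?_ ?_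
  · filter_upwards [hmem] with y hy using (lambertInv_pos (by linarith) hy).le
  · filter_upwards [hmem] with y hy
    have h := one_sub_rpow_mem_Ioo (by linarith) hy (b := b)
    have hlog := Real.one_sub_inv_le_log_of_pos h.1
    have hrp : y ^ (b - 1) * y = y ^ b := by
      rw [← Real.rpow_add_one hy.1.ne', sub_add_cancel]
    rw [lambertInv, div_le_iff₀ hy.1, div_mul_eq_mul_div, hrp]
    have hinv : 1 - (1 - y ^ b)⁻¹ = -(y ^ b / (1 - y ^ b)) := by
      have := h.1.ne'
      field_simp
      ring
    linarith

lemma tendsto_lambertInv_one (hb : 0 < b) :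
    Tendsto (lambertInv b) (nhdsWithin 1 (Set.Iio 1)) atTop := by
  have hmem : Set.Ioo (0 : ℝ) 1 ∈ nhdsWithin (1 : ℝ) (Set.Iio 1) :=
    Ioo_mem_nhdsLT zero_lt_one
  have hin : Tendsto (fun y : ℝ => 1 - y ^ b) (nhdsWithin 1 (Set.Iio 1))
      (nhdsWithin 0 (Set.Ioi 0)) := by
    refine tendsto_nhdsWithin_iff.2 ⟨?_, ?_⟩
    · simpa using ((tendsto_rpow_one_left b).mono_left nhdsWithin_le_nhds).const_sub 1
    · filter_upwards [hmem] with y hy using (one_sub_rpow_mem_Ioo hb hy).1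
  have hlog : Tendsto (fun y : ℝ => -Real.log (1 - y ^ b)) (nhdsWithin 1 (Set.Iio 1)) atTop :=
    tendsto_neg_atBot_atTop.comp (Real.tendsto_log_nhdsGT_zero.comp hin)
  refine tendsto_atTop_mono' _ ?_ hlog
  filter_upwards [hmem] with y hy
  have h := one_sub_rpow_mem_Ioo hb hy
  exact le_div_self (neg_nonneg.2 (Real.log_neg h.1 h.2).le) hy.1 hy.2.le

lemma exists_lambertInv_eq (hb : 1 < b) {x : ℝ} (hx : 0 < x) :
    ∃ y ∈ Set.Ioo (0 : ℝ) 1, lambertInv b y = x := by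
  obtain ⟨u, hu, hux⟩ := ((Ioo_mem_nhdsGT (zero_lt_one (α := ℝ)) |> Filter.eventually_iff.2).and
    ((tendsto_lambertInv_zero hb).eventually_lt_const hx)).exists
  obtain ⟨v, hv, hvx⟩ := ((Ioo_mem_nhdsLT (zero_lt_one (α := ℝ)) |> Filter.eventually_iff.2).and
    ((tendsto_lambertInv_one (zero_lt_one.trans hb)).eventually_gt_atTop x)).exists
  exact (isPreconnected_Ioo.intermediate_value hu hv (continuousOn_lambertInv hb))
    ⟨hux.le, hvx.le⟩

end lambertInv

/-- For `β > 1`: every `x > 0` admits a unique `y ∈ (0,1)` with `y^β = 1 - e^{-x y}`;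
and any function `yb` picking this solution is strictly increasing on `(0,∞)`,
differentiable there, tends to `0` as `x → 0⁺` and to `1` as `x → ∞`, and is the
cdf (on `(0,∞)`) of a non-negative absolutely continuous probability measure. -/
theorem stmt_1 (beta : ℝ) (hbeta : 1 < beta) :
    (∀ x : ℝ, 0 < x → ∃! y : ℝ, y ∈ Set.Ioo (0 : ℝ) 1 ∧
        y ^ beta = 1 - Real.exp (-(x * y))) ∧
    (∀ yb : ℝ → ℝ,
      (∀ x : ℝ, 0 < x → yb x ∈ Set.Ioo (0 : ℝ) 1 ∧
          (yb x) ^ beta = 1 - Real.exp (-(x * yb x))) →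
      StrictMonoOn yb (Set.Ioi 0) ∧
      (∀ x ∈ Set.Ioi (0 : ℝ), DifferentiableAt ℝ yb x) ∧
      Tendsto yb (nhdsWithin 0 (Set.Ioi 0)) (nhds 0) ∧
      Tendsto yb atTop (nhds 1) ∧
      ∃ μ : Measure ℝ, IsProbabilityMeasure μ ∧ μ ≪ volume ∧ μ (Set.Iio 0) = 0 ∧
        ∀ x : ℝ, 0 < x → (μ (Set.Iic x)).toReal = yb x) := by
  have hb0 : 0 < beta := zero_lt_one.trans hbeta
  have hmono := strictMonoOn_lambertInv hbeta
  refine ⟨fun x hx => ?_, fun yb hyb => ?_⟩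
  · obtain ⟨y, hy, hyx⟩ := exists_lambertInv_eq hbeta hx
    refine ⟨y, ⟨hy, (rpow_eq_one_sub_exp_iff hb0 hy).2 hyx⟩, fun z hz => ?_⟩
    exact hmono.injOn hz.1 hy (((rpow_eq_one_sub_exp_iff hb0 hz.1).1 hz.2).trans hyx.symm)
  have hmem : ∀ x, 0 < x → yb x ∈ Set.Ioo (0 : ℝ) 1 := fun x hx => (hyb x hx).1
  have hinv : ∀ x, 0 < x → lambertInv beta (yb x) = x := fun x hx =>
    (rpow_eq_one_sub_exp_iff hb0 (hmem x hx)).1 (hyb x hx).2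
  have hlt : ∀ x, 0 < x → ∀ y ∈ Set.Ioo (0 : ℝ) 1, (yb x < y ↔ x < lambertInv beta y) :=
    fun x hx y hy => by rw [← hmono.lt_iff_lt (hmem x hx) hy, hinv x hx]
  have hgt : ∀ x, 0 < x → ∀ y ∈ Set.Ioo (0 : ℝ) 1, (y < yb x ↔ lambertInv beta y < x) :=
    fun x hx y hy => by rw [← hmono.lt_iff_lt hy (hmem x hx), hinv x hx]
  have hsm : StrictMonoOn yb (Set.Ioi 0) := fun x hx z hz hxz => by
    rw [hlt x hx _ (hmem z hz), hinv z hz]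
    exact hxz
  have hcont : ∀ x, 0 < x → ContinuousAt yb x := fun x hx => by
    refine hsm.continuousAt_of_image_mem_nhds (Ioi_mem_nhds hx)
      (mem_of_superset (Ioo_mem_nhds (hmem x hx).1 (hmem x hx).2) fun y hy => ?_)
    have hp := lambertInv_pos hb0 hy
    exact ⟨lambertInv beta y, hp, hmono.injOn (hmem _ hp) hy (hinv _ hp)⟩
  have hderiv : ∀ x, 0 < x → ∃ d, 0 < d ∧ HasDerivAt yb d x := fun x hx => by
    obtain ⟨d, hd, h⟩ := exists_pos_hasDerivAt_lambertInv hbeta (hmem x hx)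
    refine ⟨d⁻¹, inv_pos.2 hd, h.of_local_left_inverse (hcont x hx) hd.ne' ?_⟩
    filter_upwards [Ioi_mem_nhds hx] with z hz using hinv z hz
  have hdiff : ∀ x, 0 < x → HasDerivAt yb (deriv yb x) x := fun x hx =>
    (hderiv x hx).choose_spec.2.differentiableAt.hasDerivAt
  have h0 : Tendsto yb (nhdsWithin 0 (Set.Ioi 0)) (nhds 0) := by
    refine tendsto_order.2 ⟨fun a ha => ?_, fun a ha => ?_⟩
    · filter_upwards [self_mem_nhdsWithin] with x hx using ha.trans (hmem x hx).1
    · obtain ⟨y, hy0, hy⟩ := exists_between (lt_min ha zero_lt_one)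
      have hy1 : y ∈ Set.Ioo (0 : ℝ) 1 := ⟨hy0, hy.trans_le (min_le_right _ _)⟩
      filter_upwards [Ioo_mem_nhdsGT (lambertInv_pos hb0 hy1)] with x hx
      exact ((hlt x hx.1 y hy1).2 hx.2).trans (hy.trans_le (min_le_left _ _))
  have h1 : Tendsto yb atTop (nhds 1) := by
    refine tendsto_order.2 ⟨fun a ha => ?_, fun a ha => ?_⟩
    · obtain ⟨y, hy, hy1⟩ := exists_between (max_lt ha zero_lt_one)
      have hy2 : y ∈ Set.Ioo (0 : ℝ) 1 := ⟨(le_max_right _ _).trans_lt hy, hy1⟩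
      filter_upwards [eventually_gt_atTop (lambertInv beta y)] with x hx
      exact ((le_max_left _ _).trans_lt hy).trans
        ((hgt x ((lambertInv_pos hb0 hy2).trans hx) y hy2).2 hx)
    · filter_upwards [eventually_gt_atTop 0] with x hx using (hmem x hx).2.trans ha
  refine ⟨hsm, fun x hx => (hdiff x hx).differentiableAt, h0, h1,
    exists_absolutelyContinuous_measure_of_hasDerivAt hdiff (fun x hx => ?_) h0 h1⟩
  obtain ⟨d, hd, h⟩ := hderiv x hx
  rw [h.deriv]
  exact hd.le
end

section
/- Fix x > 0, β > 1, α = 1/β, and let g(y) = α·x·(1 - e^{-x·y})^{α-1}·e^{-x·y} (the derivative of f(y) = (1 - e^{-x·y})^α). If y* ∈ (0,1) satisfies y* = (1 - e^{-x·y*})^α (i.e., y* is a fixed point of f), then 0 < g(y*) ≤ α < 1. -/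
open Real

/-- The inequality `t / (exp t - 1) ≤ 1` in a form without division. -/
theorem mul_exp_neg_le_one_sub_exp_neg (t : ℝ) : t * exp (-t) ≤ 1 - exp (-t) := by
  have h := mul_le_mul_of_nonneg_right (add_one_le_exp t) (exp_pos (-t)).le
  rw [← exp_add, add_neg_cancel, exp_zero] at h
  linarith

/-- Contraction at the fixed point: if `y* ∈ (0,1)` is a fixed point of
`f(y) = (1 - e^{-x y})^α` then `0 < g(y*) ≤ α < 1`, where `g = f'`. -/
theorem stmt_3 (x beta : ℝ) (hx : 0 < x) (hbeta : 1 < beta)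
    (α : ℝ) (hα : α = 1 / beta)
    (g : ℝ → ℝ)
    (hg : ∀ y : ℝ,
      g y = α * x * (1 - Real.exp (-(x * y))) ^ (α - 1) * Real.exp (-(x * y)))
    (ystar : ℝ) (hy : ystar ∈ Set.Ioo (0 : ℝ) 1)
    (hfix : ystar = (1 - Real.exp (-(x * ystar))) ^ α) :
    0 < g ystar ∧ g ystar ≤ α ∧ α < 1 := by
  obtain ⟨hy0, -⟩ := hy
  have hα0 : 0 < α := hα ▸ by positivity
  have hα1 : α < 1 := by
    rw [hα, div_lt_one (by linarith)]
    exact hbeta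
  have hu : 0 < 1 - exp (-(x * ystar)) := by
    rw [sub_pos, exp_lt_one_iff, neg_lt_zero]
    positivity
  rw [hg]
  refine ⟨by positivity, ?_, hα1⟩
  rw [rpow_sub_one hu.ne', ← hfix]
  calc α * x * (ystar / (1 - exp (-(x * ystar)))) * exp (-(x * ystar))
      = α * (x * ystar * exp (-(x * ystar)) / (1 - exp (-(x * ystar)))) := by ring
    _ ≤ α * 1 := by
      gcongr
      exact (div_le_one hu).2 (mul_exp_neg_le_one_sub_exp_neg _)
    _ = α := mul_one α
end

section
/- Fix x > 0, β > 1, α = 1/β, and let g(y) = α·x·(1 - e^{-x·y})^{α-1}·e^{-x·y} for y ∈ (0,1]. Then: (1) g is strictly monotonically decreasing on (0,1]; (2) g(y) → +∞ as y → 0+; (3) if y* ∈ (0,1) is the fixed point of f(y) = (1 - e^{-x·y})^α, then g(y) < α for all y with y* < y ≤ 1. -/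
open Real

/-- Properties of `g(y) = α x (1 - e^{-x y})^{α-1} e^{-x y}`: strictly decreasing on
`(0,1]`, blows up at `0⁺`, and `g(y) < α` beyond the fixed point. -/
theorem stmt_4 (x beta : ℝ) (hx : 0 < x) (hbeta : 1 < beta)
    (α : ℝ) (hα : α = 1 / beta)
    (g : ℝ → ℝ)
    (hg : ∀ y : ℝ,
      g y = α * x * (1 - Real.exp (-(x * y))) ^ (α - 1) * Real.exp (-(x * y))) :
    StrictAntiOn g (Set.Ioc (0 : ℝ) 1) ∧
    Filter.Tendsto g (nhdsWithin 0 (Set.Ioi 0)) Filter.atTop ∧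
    (∀ ystar : ℝ, ystar ∈ Set.Ioo (0 : ℝ) 1 →
      ystar = (1 - Real.exp (-(x * ystar))) ^ α →
      ∀ y : ℝ, ystar < y → y ≤ 1 → g y < α) := by
  have hα0 : 0 < α := by rw [hα]; positivity
  have hα1 : α - 1 < 0 := by
    rw [hα, sub_neg, div_lt_one (by linarith)]; exact hbeta
  have hbase : ∀ y : ℝ, 0 < y → 0 < 1 - exp (-(x * y)) := fun y hy => by
    have := mul_pos hx hy
    rw [sub_pos, exp_lt_one_iff]; linarith
  have hanti : StrictAntiOn g (Set.Ioc (0 : ℝ) 1) := by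
    intro a ha b hb hab
    have hexp : exp (-(x * b)) < exp (-(x * a)) :=
      exp_lt_exp.2 (neg_lt_neg (mul_lt_mul_of_pos_left hab hx))
    have hpow : (1 - exp (-(x * b))) ^ (α - 1) < (1 - exp (-(x * a))) ^ (α - 1) :=
      rpow_lt_rpow_of_neg (hbase a ha.1) (by linarith) hα1
    have := rpow_pos_of_pos (hbase b hb.1) (α - 1)
    rw [hg, hg]
    gcongr
  refine ⟨hanti, ?_, ?_⟩
  · have hexp : Filter.Tendsto (fun y : ℝ => exp (-(x * y))) (nhdsWithin 0 (Set.Ioi 0))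
        (nhds 1) := by
      have h : Continuous fun y : ℝ => exp (-(x * y)) := by fun_prop
      simpa using (h.tendsto 0).mono_left nhdsWithin_le_nhds
    have hbase0 : Filter.Tendsto (fun y : ℝ => 1 - exp (-(x * y))) (nhdsWithin 0 (Set.Ioi 0))
        (nhdsWithin 0 (Set.Ioi 0)) := by
      refine tendsto_nhdsWithin_iff.2 ⟨by simpa using hexp.const_sub 1, ?_⟩
      filter_upwards [self_mem_nhdsWithin] with y hy using hbase y hy
    have hpow := (tendsto_rpow_neg_nhdsGT_zero hα1).comp hbase0
    rw [funext hg]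
    exact (hpow.const_mul_atTop (mul_pos hα0 hx)).atTop_mul_pos one_pos hexp
  · intro ystar hy hfix y hlt hle
    refine (hanti ⟨hy.1, hy.2.le⟩ ⟨hy.1.trans hlt, hle⟩ hlt).trans ?_
    have hu := hbase ystar hy.1
    have ht := mul_pos hx hy.1
    have hkey : x * ystar * exp (-(x * ystar)) < 1 - exp (-(x * ystar)) := by
      have h := mul_lt_mul_of_pos_right (add_one_lt_exp ht.ne') (exp_pos (-(x * ystar)))
      rw [← exp_add, add_neg_cancel, exp_zero] at h
      linarith
    rw [hg, rpow_sub_one hu.ne', ← hfix]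
    calc α * x * (ystar / (1 - exp (-(x * ystar)))) * exp (-(x * ystar))
        = α * (x * ystar * exp (-(x * ystar)) / (1 - exp (-(x * ystar)))) := by ring
      _ < α * 1 := by
        gcongr
        exact (div_lt_one hu).2 hkey
      _ = α := mul_one α
end

section
/- Fix x > 0, β > 1, α = 1/β. Define the sequence (y_n) by y_1 = 1 and y_{n+1} = (1 - e^{-x·y_n})^α for n ≥ 1. Then the sequence (y_n) converges, and its limit is the unique y ∈ (0,1) satisfying y^β = 1 - e^{-x·y} (i.e., the value y_β(x) of the generalized Lambert function). This establishes the continued exponential representation y_β(x) = lim_n y_n. -/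
open Real

/-- The function `1 - e^{-x t}` dominates `t ^ β` at some point of `(0, 1)`. -/
lemma exists_rpow_le_one_sub_exp {x β : ℝ} (hx : 0 < x) (hβ : 1 < β) :
    ∃ c ∈ Set.Ioo (0 : ℝ) 1, c ^ β ≤ 1 - exp (-(x * c)) := by
  have hr0 : 0 < x / (1 + x) := by positivity
  have hr1 : x / (1 + x) < 1 := by rw [div_lt_one (by positivity)]; linarith
  have hβ' : 0 < β - 1 := sub_pos.mpr hβ
  set c := (x / (1 + x)) ^ (β - 1)⁻¹ with hc
  have hc0 : 0 < c := rpow_pos_of_pos hr0 _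
  have hc1 : c < 1 := rpow_lt_one hr0.le hr1 (inv_pos.mpr hβ')
  have hpow : c ^ β = x / (1 + x) * c := by
    rw [← rpow_inv_rpow hr0.le hβ'.ne', ← hc, ← rpow_add_one hc0.ne', sub_add_cancel]
  have hxc : 0 < x * c := mul_pos hx hc0
  have hexp : exp (-(x * c)) ≤ 1 / (1 + x * c) := by
    rw [exp_neg, ← one_div]
    exact one_div_le_one_div_of_le (by positivity) (by linarith [add_one_le_exp (x * c)])
  have hfrac : x / (1 + x) * c ≤ 1 - 1 / (1 + x * c) := by
    rw [one_sub_div (by positivity), div_mul_eq_mul_div, add_sub_cancel_left]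
    exact div_le_div_of_nonneg_left hxc.le (by positivity) (by nlinarith)
  exact ⟨c, ⟨hc0, hc1⟩, by linarith⟩

/-- Below a positive solution of `t ^ β = 1 - e^{-x t}` there is no other one. -/
lemma rpow_lt_one_sub_exp_of_lt {x β a b : ℝ} (hβ : 1 < β) (ha : 0 < a) (hab : a < b)
    (hb : b ^ β = 1 - exp (-(x * b))) : a ^ β < 1 - exp (-(x * a)) := by
  have hb0 : 0 < b := ha.trans hab
  have ht0 : 0 < a / b := div_pos ha hb0
  have ht1 : 0 < 1 - a / b := by rw [sub_pos, div_lt_one hb0]; exact hab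
  have hconv := (strictConvexOn_rpow hβ).2 (Set.mem_Ici.mpr hb0.le)
    (Set.mem_Ici.mpr le_rfl) hb0.ne' ht0 ht1 (by ring)
  have hexp := convexOn_exp.2 (Set.mem_univ (-(x * b))) (Set.mem_univ 0)
    ht0.le ht1.le (by ring)
  have hexpEq : a / b * -(x * b) = -(x * a) := by field_simp
  simp only [smul_eq_mul, mul_zero, add_zero, div_mul_cancel₀ a hb0.ne',
    zero_rpow (zero_lt_one.trans hβ).ne', hexpEq, exp_zero, mul_one] at hconv hexp
  rw [hb] at hconv
  linarith

/-- The equation `t ^ β = 1 - e^{-x t}` has at most one positive solution. -/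
lemma eq_of_rpow_eq_one_sub_exp {x β a b : ℝ} (hβ : 1 < β) (ha : 0 < a) (hb : 0 < b)
    (hae : a ^ β = 1 - exp (-(x * a))) (hbe : b ^ β = 1 - exp (-(x * b))) : a = b := by
  rcases lt_trichotomy a b with h | h | h
  · exact absurd hae (rpow_lt_one_sub_exp_of_lt hβ ha h hbe).ne
  · exact h
  · exact absurd hbe (rpow_lt_one_sub_exp_of_lt hβ hb h hae).ne

/-- The iteration started at `1` converges to a solution of `t ^ β = 1 - e^{-x t}` in `(0, 1)`. -/
lemma exists_tendsto_continued_exp {x β : ℝ} (hx : 0 < x) (hβ : 1 < β) {y : ℕ → ℝ}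
    (h0 : y 0 = 1) (hrec : ∀ n, y (n + 1) = (1 - exp (-(x * y n))) ^ β⁻¹) :
    ∃ L ∈ Set.Ioo (0 : ℝ) 1, L ^ β = 1 - exp (-(x * L)) ∧
      Filter.Tendsto y Filter.atTop (nhds L) := by
  have hβ0 : 0 < β := zero_lt_one.trans hβ
  have hα : 0 < β⁻¹ := inv_pos.mpr hβ0
  have hnonneg : ∀ {t : ℝ}, 0 ≤ t → 0 ≤ 1 - exp (-(x * t)) := fun ht => by
    rw [sub_nonneg, exp_le_one_iff, neg_nonpos]; positivity
  have hmono : ∀ {s t : ℝ}, 0 ≤ s → s ≤ t →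
      (1 - exp (-(x * s))) ^ β⁻¹ ≤ (1 - exp (-(x * t))) ^ β⁻¹ := fun hs hst => by
    have := hnonneg hs
    gcongr
  obtain ⟨c, ⟨hc0, hc1⟩, hc⟩ := exists_rpow_le_one_sub_exp hx hβ
  have hcT : c ≤ (1 - exp (-(x * c))) ^ β⁻¹ := by
    calc c = (c ^ β) ^ β⁻¹ := (rpow_rpow_inv hc0.le hβ0.ne').symm
      _ ≤ _ := rpow_le_rpow (by positivity) hc hα.le
  have hlb : ∀ n, c ≤ y n := by
    intro n
    induction n with
    | zero => rw [h0]; exact hc1.le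
    | succ n ih => rw [hrec]; exact hcT.trans (hmono hc0.le ih)
  have hanti : Antitone y := antitone_nat_of_succ_le fun n => by
    induction n with
    | zero =>
      rw [hrec, h0]
      exact rpow_le_one (hnonneg zero_le_one) (by linarith [exp_pos (-(x * 1))]) hα.le
    | succ n ih =>
      rw [hrec (n + 1), hrec n]
      exact hmono (hrec n ▸ hc0.le.trans (hlb (n + 1))) (hrec n ▸ ih)
  have hlim := tendsto_atTop_ciInf hanti ⟨c, by rintro _ ⟨n, rfl⟩; exact hlb n⟩
  set L := ⨅ n, y n
  have hL0 : 0 < L := hc0.trans_le (ge_of_tendsto' hlim hlb)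
  have hcont : Continuous fun t : ℝ => (1 - exp (-(x * t))) ^ β⁻¹ :=
    Continuous.rpow_const (by fun_prop) fun _ => Or.inr hα.le
  have hfix : L = (1 - exp (-(x * L))) ^ β⁻¹ := by
    refine tendsto_nhds_unique (hlim.comp (Filter.tendsto_add_atTop_nat 1)) ?_
    simpa only [Function.comp_def, hrec] using (hcont.tendsto L).comp hlim
  refine ⟨L, ⟨hL0, ?_⟩, ?_, hlim⟩
  · rw [hfix]
    exact rpow_lt_one (hnonneg hL0.le) (by linarith [exp_pos (-(x * L))]) hα
  · conv_lhs => rw [hfix]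
    exact rpow_inv_rpow (hnonneg hL0.le) hβ0.ne'

/-- Continued exponential representation: the iteration `y₁ = 1`,
`y_{n+1} = (1 - e^{-x yₙ})^α` converges to the unique `y ∈ (0,1)` with
`y^β = 1 - e^{-x y}`. -/
theorem stmt_5 (x beta : ℝ) (hx : 0 < x) (hbeta : 1 < beta)
    (α : ℝ) (hα : α = 1 / beta)
    (y : ℕ → ℝ) (h0 : y 0 = 1)
    (hrec : ∀ n : ℕ, y (n + 1) = (1 - Real.exp (-(x * y n))) ^ α) :
    (∃! L : ℝ, L ∈ Set.Ioo (0 : ℝ) 1 ∧ L ^ beta = 1 - Real.exp (-(x * L))) ∧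
    (∀ L : ℝ, L ∈ Set.Ioo (0 : ℝ) 1 → L ^ beta = 1 - Real.exp (-(x * L)) →
      Filter.Tendsto y Filter.atTop (nhds L)) := by
  subst hα
  obtain ⟨L, hL, hLe, hlim⟩ :=
    exists_tendsto_continued_exp hx hbeta h0 (by simpa only [one_div] using hrec)
  have huniq : ∀ M : ℝ, M ∈ Set.Ioo (0 : ℝ) 1 → M ^ beta = 1 - Real.exp (-(x * M)) → M = L :=
    fun M hM hMe => eq_of_rpow_eq_one_sub_exp hbeta hM.1 hL.1 hMe hLe
  exact ⟨⟨L, ⟨hL, hLe⟩, fun M hM => huniq M hM.1 hM.2⟩,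
    fun M hM hMe => huniq M hM hMe ▸ hlim⟩
end

section
/- Fix x > 0, β > 1, α = 1/β, and let θ ∈ (0,1] be arbitrary. Define the sequence (y_n) by y_1 = (1 - e^{-x·θ})^α and y_{n+1} = (1 - e^{-x·y_n})^α for n ≥ 1. Then (y_n) converges to the unique y ∈ (0,1) satisfying y^β = 1 - e^{-x·y}; i.e., the limit of the continued exponential iteration does not depend on the initial value θ. -/
open Real

/-- Concavity of `b ↦ 1 - e^{-b}` along the segment from `0`. -/
theorem mul_one_sub_exp_neg_le {s : ℝ} (hs0 : 0 ≤ s) (hs1 : s ≤ 1) (b : ℝ) :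
    s * (1 - exp (-b)) ≤ 1 - exp (-(s * b)) := by
  have h := convexOn_exp.2 (Set.mem_univ (-b)) (Set.mem_univ 0) hs0 (sub_nonneg.2 hs1) (by ring)
  simp only [smul_eq_mul, mul_zero, add_zero, exp_zero, mul_one, mul_neg] at h
  linarith

theorem one_sub_exp_neg_mul_le {s : ℝ} (hs : 1 ≤ s) (b : ℝ) :
    1 - exp (-(s * b)) ≤ s * (1 - exp (-b)) := by
  have hs0 : 0 < s := by linarith
  have h := mul_one_sub_exp_neg_le (inv_nonneg.2 hs0.le) (inv_le_one_of_one_le₀ hs) (s * b)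
  rwa [inv_mul_cancel_left₀ hs0.ne', inv_mul_le_iff₀ hs0] at h

/-- One step of the iteration `t ↦ (1 - e^{-xt})^α` raises lower and upper bounds on the ratio
of `t` to a fixed point `L` to the power `α`. -/
theorem one_sub_exp_neg_rpow_bounds {x α L : ℝ} (hx : 0 < x) (hα : 0 < α) (hL : 0 < L)
    (hfix : (1 - exp (-(x * L))) ^ α = L) {m M t : ℝ} (hm0 : 0 < m) (hm1 : m ≤ 1) (hM : 1 ≤ M)
    (hmt : m * L ≤ t) (htM : t ≤ M * L) :
    m ^ α * L ≤ (1 - exp (-(x * t))) ^ α ∧ (1 - exp (-(x * t))) ^ α ≤ M ^ α * L := by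
  have hc : 0 ≤ 1 - exp (-(x * L)) :=
    sub_nonneg.2 (exp_le_one_iff.2 (neg_nonpos.2 (by positivity)))
  have ht : 0 < t := (mul_pos hm0 hL).trans_le hmt
  have hct : 0 ≤ 1 - exp (-(x * t)) :=
    sub_nonneg.2 (exp_le_one_iff.2 (neg_nonpos.2 (by positivity)))
  have hmono : ∀ {u v : ℝ}, u ≤ v → 1 - exp (-(x * u)) ≤ 1 - exp (-(x * v)) := fun h =>
    sub_le_sub_left (exp_le_exp.2 (neg_le_neg (mul_le_mul_of_nonneg_left h hx.le))) 1
  constructor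
  · calc m ^ α * L = (m * (1 - exp (-(x * L)))) ^ α := by rw [mul_rpow hm0.le hc, hfix]
      _ ≤ _ := by
        refine rpow_le_rpow (by positivity) ?_ hα.le
        refine (mul_one_sub_exp_neg_le hm0.le hm1 _).trans ?_
        rw [mul_left_comm]
        exact hmono hmt
  · calc (1 - exp (-(x * t))) ^ α ≤ (M * (1 - exp (-(x * L)))) ^ α := by
          refine rpow_le_rpow hct (le_trans ?_ (one_sub_exp_neg_mul_le hM _)) hα.le
          rw [mul_left_comm]
          exact hmono htM
      _ = M ^ α * L := by rw [mul_rpow (by linarith) hc, hfix]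

theorem tendsto_one_sub_exp_neg_rpow_iterate {x α L θ : ℝ} (hx : 0 < x) (hα0 : 0 < α)
    (hα1 : α < 1) (hL : 0 < L) (hfix : (1 - exp (-(x * L))) ^ α = L) (hθ : 0 < θ)
    {y : ℕ → ℝ} (h0 : y 0 = (1 - exp (-(x * θ))) ^ α)
    (hrec : ∀ n, y (n + 1) = (1 - exp (-(x * y n))) ^ α) :
    Filter.Tendsto y Filter.atTop (nhds L) := by
  set m := min (θ / L) 1
  set M := max (θ / L) 1
  have hm0 : 0 < m := lt_min (by positivity) one_pos
  have hm1 : m ≤ 1 := min_le_right _ _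
  have hM : 1 ≤ M := le_max_right _ _
  have key : ∀ n, m ^ α ^ (n + 1) * L ≤ y n ∧ y n ≤ M ^ α ^ (n + 1) * L := by
    intro n
    induction n with
    | zero =>
      rw [h0, zero_add, pow_one]
      exact one_sub_exp_neg_rpow_bounds hx hα0 hL hfix hm0 hm1 hM
        ((le_div_iff₀ hL).1 (min_le_left _ _)) ((div_le_iff₀ hL).1 (le_max_left _ _))
    | succ n ih =>
      rw [hrec, pow_succ _ (n + 1), rpow_mul hm0.le, rpow_mul (by linarith)]
      exact one_sub_exp_neg_rpow_bounds hx hα0 hL hfix (by positivity)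
        (rpow_le_one hm0.le hm1 (by positivity)) (one_le_rpow hM (by positivity)) ih.1 ih.2
  have hlim : ∀ c : ℝ, 0 < c →
      Filter.Tendsto (fun n : ℕ => c ^ α ^ (n + 1) * L) Filter.atTop (nhds L) := by
    intro c hc
    have hpow := (tendsto_pow_atTop_nhds_zero_of_lt_one hα0.le hα1).comp
      (Filter.tendsto_add_atTop_nat 1)
    simpa using ((continuousAt_const_rpow (b := 0) hc.ne').tendsto.comp hpow).mul_const L
  exact tendsto_of_tendsto_of_tendsto_of_le_of_le (hlim m hm0) (hlim M (by linarith))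
    (fun n => (key n).1) (fun n => (key n).2)

theorem exists_rpow_eq_one_sub_exp_neg {x β : ℝ} (hx : 0 < x) (hβ : 1 < β) :
    ∃ L ∈ Set.Ioo (0 : ℝ) 1, L ^ β = 1 - exp (-(x * L)) := by
  set c := 1 - exp (-x)
  have hc0 : 0 < c := sub_pos.2 (exp_lt_one_iff.2 (by linarith))
  have hc1 : c < 1 := by linarith [exp_pos (-x)]
  have hβ' : 0 < β - 1 := by linarith
  set a := c ^ (β - 1)⁻¹
  have ha0 : 0 < a := by positivity
  have ha1 : a ≤ 1 := rpow_le_one hc0.le hc1.le (by positivity)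
  have haβ : a ^ β = a * c := by
    rw [← rpow_inv_rpow hc0.le hβ'.ne', ← rpow_one_add' ha0.le (by linarith)]
    ring_nf
  have hle : a ^ β - (1 - exp (-(x * a))) ≤ 0 := by
    rw [haβ, mul_comm x a]
    linarith [mul_one_sub_exp_neg_le ha0.le ha1 x]
  have hcont : ContinuousOn (fun t : ℝ => t ^ β - (1 - exp (-(x * t)))) (Set.Icc a 1) :=
    ((continuous_rpow_const (by linarith)).sub (by fun_prop)).continuousOn
  have hpos : 0 < (1 : ℝ) ^ β - (1 - exp (-(x * 1))) := by
    simpa using exp_pos (-x)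
  obtain ⟨t, ht, hft⟩ := intermediate_value_Icc ha1 hcont ⟨hle, hpos.le⟩
  refine ⟨t, ⟨ha0.trans_le ht.1, lt_of_le_of_ne ht.2 ?_⟩, sub_eq_zero.1 hft⟩
  rintro rfl
  exact hpos.ne' hft

/-- The continued exponential iteration started from any `θ ∈ (0,1]` converges to the
unique `y ∈ (0,1)` with `y^β = 1 - e^{-x y}`; the limit does not depend on `θ`. -/
theorem stmt_6 (x beta : ℝ) (hx : 0 < x) (hbeta : 1 < beta)
    (α : ℝ) (hα : α = 1 / beta)
    (θ : ℝ) (hθ : θ ∈ Set.Ioc (0 : ℝ) 1)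
    (y : ℕ → ℝ) (h0 : y 0 = (1 - Real.exp (-(x * θ))) ^ α)
    (hrec : ∀ n : ℕ, y (n + 1) = (1 - Real.exp (-(x * y n))) ^ α) :
    (∃! L : ℝ, L ∈ Set.Ioo (0 : ℝ) 1 ∧ L ^ beta = 1 - Real.exp (-(x * L))) ∧
    (∀ L : ℝ, L ∈ Set.Ioo (0 : ℝ) 1 → L ^ beta = 1 - Real.exp (-(x * L)) →
      Filter.Tendsto y Filter.atTop (nhds L)) := by
  have hβ0 : 0 < beta := by linarith
  have hα0 : 0 < α := by rw [hα]; positivity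
  have hα1 : α < 1 := by rwa [hα, div_lt_one hβ0]
  have hlim : ∀ L : ℝ, L ∈ Set.Ioo (0 : ℝ) 1 → L ^ beta = 1 - exp (-(x * L)) →
      Filter.Tendsto y Filter.atTop (nhds L) := by
    intro L hL hLeq
    refine tendsto_one_sub_exp_neg_rpow_iterate hx hα0 hα1 hL.1 ?_ hθ.1 h0 hrec
    rw [← hLeq, hα, one_div, rpow_rpow_inv hL.1.le hβ0.ne']
  obtain ⟨L, hL, hLeq⟩ := exists_rpow_eq_one_sub_exp_neg hx hbeta
  exact ⟨⟨L, ⟨hL, hLeq⟩, fun K hK => tendsto_nhds_unique (hlim K hK.1 hK.2) (hlim L hL hLeq)⟩,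
    hlim⟩
end

section
/- Fix x > 0 and let 1 < β₁ < β₂. If y₁ ∈ (0,1) satisfies y₁^{β₁} = 1 - e^{-x·y₁} and y₂ ∈ (0,1) satisfies y₂^{β₂} = 1 - e^{-x·y₂}, then y₁ < y₂. In other words, for each fixed x > 0 the generalized Lambert function y_β(x) is a strictly increasing function of the parameter β on (1, ∞). -/
open Real

/-- For fixed `x > 0`, the generalized Lambert function is strictly increasing
in the parameter `β > 1`. -/
theorem stmt_7 (x : ℝ) (hx : 0 < x)
    (beta1 beta2 : ℝ) (h1 : 1 < beta1) (h12 : beta1 < beta2)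
    (y1 y2 : ℝ) (hy1 : y1 ∈ Set.Ioo (0 : ℝ) 1) (hy2 : y2 ∈ Set.Ioo (0 : ℝ) 1)
    (he1 : y1 ^ beta1 = 1 - Real.exp (-(x * y1)))
    (he2 : y2 ^ beta2 = 1 - Real.exp (-(x * y2))) :
    y1 < y2 := by
  obtain ⟨hy1, -⟩ := hy1
  obtain ⟨hy2, hy2_lt⟩ := hy2
  by_contra! hle
  obtain ⟨t, rfl⟩ : ∃ t, y2 = t * y1 := ⟨y2 / y1, (div_mul_cancel₀ y2 hy1.ne').symm⟩
  have ht : 0 < t := pos_of_mul_pos_left hy2 hy1.le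
  have ht1 : t ≤ 1 := by nlinarith
  -- Concavity of `y ↦ 1 - exp (-(x * y))`, which vanishes at `0`.
  have hconc : t * (1 - exp (-(x * y1))) ≤ 1 - exp (-(x * (t * y1))) := by
    have h := convexOn_exp.2 (Set.mem_univ (-(x * y1))) (Set.mem_univ 0) ht.le
      (sub_nonneg.2 ht1) (by ring)
    simp only [smul_eq_mul, mul_zero, add_zero, exp_zero, mul_one] at h
    rw [show -(x * (t * y1)) = t * -(x * y1) by ring]
    linarith
  refine hconc.not_gt ?_
  rw [← he1, ← he2]
  calc (t * y1) ^ beta2 < (t * y1) ^ beta1 := rpow_lt_rpow_of_exponent_gt hy2 hy2_lt h12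
    _ = t ^ beta1 * y1 ^ beta1 := mul_rpow ht.le hy1.le
    _ ≤ t * y1 ^ beta1 := by
      gcongr
      exact rpow_le_self_of_le_one ht.le ht1 h1.le
end

section
/- Let β > 1 and for x > 0 let y_β(x) denote the unique y ∈ (0,1) with y^β = 1 - e^{-x·y}. Then for all x > 0 the two-sided inequality (1 - e^{-x})^{1/(β-1)} < y_β(x) < (1 - e^{-x})^{1/β} holds. -/
open Real

/-- Strict convexity of `t ↦ e^{-xt}` on `[0, 1]`, written as a chord bound. -/
lemma mul_one_sub_exp_neg_lt {x y : ℝ} (hx : x ≠ 0) (hy0 : 0 < y) (hy1 : y < 1) :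
    y * (1 - Real.exp (-x)) < 1 - Real.exp (-(x * y)) := by
  have h := strictConvexOn_exp.2 (Set.mem_univ (-x)) (Set.mem_univ 0) (neg_ne_zero.mpr hx)
    hy0 (sub_pos.mpr hy1) (add_sub_cancel y 1)
  simp only [smul_eq_mul, mul_zero, add_zero, Real.exp_zero, mul_one] at h
  rw [show y * -x = -(x * y) by ring] at h
  linarith

/-- Two-sided bounds: `(1-e^{-x})^{1/(β-1)} < y_β(x) < (1-e^{-x})^{1/β}` for `x > 0`. -/
theorem stmt_8 (beta : ℝ) (hbeta : 1 < beta)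
    (yb : ℝ → ℝ)
    (hyb : ∀ x : ℝ, 0 < x → yb x ∈ Set.Ioo (0 : ℝ) 1 ∧
        (yb x) ^ beta = 1 - Real.exp (-(x * yb x))) :
    ∀ x : ℝ, 0 < x →
      (1 - Real.exp (-x)) ^ (1 / (beta - 1)) < yb x ∧
      yb x < (1 - Real.exp (-x)) ^ (1 / beta) := by
  intro x hx
  obtain ⟨⟨hy0, hy1⟩, hy⟩ := hyb x hx
  have hpos : 0 ≤ 1 - Real.exp (-x) :=
    sub_nonneg.mpr (Real.exp_le_one_iff.mpr (neg_nonpos.mpr hx.le))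
  rw [one_div, one_div, Real.rpow_inv_lt_iff_of_pos hpos hy0.le (sub_pos.mpr hbeta),
    Real.lt_rpow_inv_iff_of_pos hy0.le hpos (by linarith), hy]
  constructor
  · rw [Real.rpow_sub_one hy0.ne', hy, lt_div_iff₀ hy0, mul_comm]
    exact mul_one_sub_exp_neg_lt hx.ne' hy0 hy1
  · gcongr
    exact mul_lt_of_lt_one_right hx hy1
end

section
/- Let β > 1 and for x > 0 let y_β(x) denote the unique y ∈ (0,1) with y^β = 1 - e^{-x·y}. Then y_β(x) · x^{-1/(β-1)} → 1 as x → 0+; that is, y_β(x) is asymptotically equivalent to x^{1/(β-1)} on the lower tail. -/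
open Real Filter

/-- Two-sided bounds on a solution `y ∈ (0, 1)` of `y ^ β = 1 - exp (-(x * y))`, rescaled by
`x ^ (-(1 / (β - 1)))`. -/
theorem mul_rpow_mem_Icc_of_rpow_eq_one_sub_exp {beta x y : ℝ} (hbeta : 1 < beta) (hx : 0 < x)
    (hy : y ∈ Set.Ioo (0 : ℝ) 1) (h : y ^ beta = 1 - Real.exp (-(x * y))) :
    y * x ^ (-(1 / (beta - 1))) ∈ Set.Icc (Real.exp (-x * (1 / (beta - 1)))) 1 := by
  obtain ⟨hy0, hy1⟩ := hy
  have hb : 0 < beta - 1 := sub_pos.2 hbeta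
  have hc : 0 ≤ 1 / (beta - 1) := by positivity
  have hpow : y ^ beta = y ^ (beta - 1) * y := by
    rw [← Real.rpow_add_one hy0.ne', sub_add_cancel]
  have hupper : y ^ (beta - 1) ≤ x := by
    have := Real.add_one_le_exp (-(x * y))
    refine le_of_mul_le_mul_right ?_ hy0
    linarith
  have hlower : x * Real.exp (-x) ≤ y ^ (beta - 1) := by
    refine le_of_mul_le_mul_right ?_ hy0
    have h1 := Real.add_one_le_exp (x * y)
    have h2 : Real.exp (-x) ≤ Real.exp (-(x * y)) := Real.exp_le_exp.2 (by nlinarith)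
    have h3 : Real.exp (-(x * y)) * Real.exp (x * y) = 1 := by
      rw [← Real.exp_add, neg_add_cancel, Real.exp_zero]
    have h4 := mul_le_mul_of_nonneg_left h1 (Real.exp_pos (-(x * y))).le
    have h5 := mul_le_mul_of_nonneg_left h2 (mul_pos hx hy0).le
    rw [← hpow, h]
    linarith
  have hroot : (y ^ (beta - 1)) ^ (1 / (beta - 1)) = y := by
    rw [← Real.rpow_mul hy0.le, mul_one_div_cancel hb.ne', Real.rpow_one]
  have hxc : 0 < x ^ (1 / (beta - 1)) := Real.rpow_pos_of_pos hx _
  rw [Real.rpow_neg hx.le, ← div_eq_mul_inv, Set.mem_Icc, le_div_iff₀ hxc, div_le_one₀ hxc]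
  constructor
  · have := Real.rpow_le_rpow (by positivity) hlower hc
    rwa [hroot, Real.mul_rpow hx.le (Real.exp_pos _).le, ← Real.exp_mul, mul_comm] at this
  · have := Real.rpow_le_rpow (by positivity) hupper hc
    rwa [hroot] at this

/-- Lower tail asymptotics: `y_β(x) ~ x^{1/(β-1)}` as `x → 0⁺`. -/
theorem stmt_10 (beta : ℝ) (hbeta : 1 < beta)
    (yb : ℝ → ℝ)
    (hyb : ∀ x : ℝ, 0 < x → yb x ∈ Set.Ioo (0 : ℝ) 1 ∧
        (yb x) ^ beta = 1 - Real.exp (-(x * yb x))) :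
    Tendsto (fun x : ℝ => yb x * x ^ (-(1 / (beta - 1))))
      (nhdsWithin 0 (Set.Ioi 0)) (nhds 1) := by
  have hlim : Tendsto (fun x : ℝ => Real.exp (-x * (1 / (beta - 1))))
      (nhdsWithin 0 (Set.Ioi 0)) (nhds 1) := by
    have hcont : Continuous fun x : ℝ => Real.exp (-x * (1 / (beta - 1))) := by fun_prop
    simpa using (hcont.tendsto 0).mono_left nhdsWithin_le_nhds
  have hbounds : ∀ᶠ x in nhdsWithin (0 : ℝ) (Set.Ioi 0), yb x * x ^ (-(1 / (beta - 1))) ∈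
      Set.Icc (Real.exp (-x * (1 / (beta - 1)))) 1 := by
    filter_upwards [self_mem_nhdsWithin] with x hx
    exact mul_rpow_mem_Icc_of_rpow_eq_one_sub_exp hbeta hx (hyb x hx).1 (hyb x hx).2
  exact tendsto_of_tendsto_of_tendsto_of_le_of_le' hlim tendsto_const_nhds
    (hbounds.mono fun _ hx => hx.1) (hbounds.mono fun _ hx => hx.2)
end

section
/- Let β > 1 and for x > 0 let y_β(x) denote the unique y ∈ (0,1) with y^β = 1 - e^{-x·y}. Set t(x) = x^{β/(β-1)}. Then as x → 0+, y_β(x) · x^{-1/(β-1)} = 1 - t(x)/(2(β-1)) + (β+8)·t(x)²/(24(β-1)²) - (β+3)·t(x)³/(12(β-1)³) + o(t(x)³); that is, the quantity (y_β(x)·x^{-1/(β-1)} - 1 + t(x)/(2(β-1)) - (β+8)t(x)²/(24(β-1)²) + (β+3)t(x)³/(12(β-1)³)) / t(x)³ tends to 0 as x → 0+. -/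
open Real Filter

/-- Taylor expansion of `exp` at `0` with the remainder as a vanishing multiple of `x ^ n`. -/
lemma exists_exp_taylor_remainder (n : ℕ) :
    ∃ d : ℝ → ℝ, Tendsto d (nhds 0) (nhds 0) ∧
      ∀ x, exp x = ∑ i ∈ Finset.range (n + 1), x ^ i / (i.factorial : ℝ) + d x * x ^ n := by
  refine ⟨_, (Real.exp_sub_sum_range_succ_isLittleO_pow n).tendsto_div_nhds_zero, fun x => ?_⟩
  rcases eq_or_ne x 0 with rfl | hx
  · simp [Finset.sum_range_succ']
  · field_simp
    ring_nf

/-- Third-order Taylor expansion of `log (1 + z)` at `0`, with the remainder as a vanishing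
multiple of `z ^ 3`. -/
lemma exists_log_one_add_taylor_remainder :
    ∃ d : ℝ → ℝ, Tendsto d (nhds 0) (nhds 0) ∧
      ∀ z, log (1 + z) = z - z ^ 2 / 2 + z ^ 3 / 3 + d z * z ^ 3 := by
  refine ⟨fun z => (log (1 + z) - (z - z ^ 2 / 2 + z ^ 3 / 3)) / z ^ 3, ?_, fun z => ?_⟩
  · have hlim : Tendsto (fun z : ℝ => |z| / (1 - |z|)) (nhds 0) (nhds 0) := by
      have hc : ContinuousAt (fun z : ℝ => |z| / (1 - |z|)) 0 := by
        refine ContinuousAt.div (by fun_prop) (by fun_prop) (by simp)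
      simpa [ContinuousAt] using hc
    refine squeeze_zero_norm' ?_ hlim
    filter_upwards [Metric.ball_mem_nhds (0 : ℝ) one_pos] with z hz
    have hz1 : |z| < 1 := by simpa using hz
    rcases eq_or_ne z 0 with rfl | hz0
    · simp
    have h := abs_log_sub_add_sum_range_le (x := -z) (by simpa using hz1) 3
    simp only [Finset.sum_range_succ, Finset.sum_range_zero, abs_neg, sub_neg_eq_add] at h
    rw [Real.norm_eq_abs, abs_div, abs_pow, div_le_iff₀ (by positivity)]
    calc |log (1 + z) - (z - z ^ 2 / 2 + z ^ 3 / 3)|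
        = _ := by congr 1; push_cast; ring
      _ ≤ _ := h
      _ = _ := by rw [pow_succ', div_mul_eq_mul_div]
  · rcases eq_or_ne z 0 with rfl | hz
    · simp
    · field_simp
      ring_nf

/-- Expansion of `log ((1 - exp (-s)) / s)` to third order as `s → 0⁺`. -/
lemma exists_log_one_sub_exp_neg_div_remainder :
    ∃ e : ℝ → ℝ, Tendsto e (nhdsWithin 0 (Set.Ioi 0)) (nhds 0) ∧
      ∀ s, 0 < s → log ((1 - exp (-s)) / s) = -s / 2 + s ^ 2 / 24 + e s * s ^ 3 := by
  obtain ⟨d₁, hd₁, hexp⟩ := exists_exp_taylor_remainder 4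
  obtain ⟨d₂, hd₂, hlog⟩ := exists_log_one_add_taylor_remainder
  have hs : Tendsto (fun s : ℝ => s) (nhdsWithin 0 (Set.Ioi 0)) (nhds 0) :=
    tendsto_id.mono_left nhdsWithin_le_nhds
  have hl : Tendsto (fun s => d₁ (-s)) (nhdsWithin 0 (Set.Ioi 0)) (nhds 0) :=
    hd₁.comp (by simpa using hs.neg)
  let m : ℝ × ℝ → ℝ := fun p => -1 / 2 + p.1 * (1 / 6 + p.1 * (-1 / 24 - p.2))
  have hm : Tendsto (fun s => s * m (s, d₁ (-s))) (nhdsWithin 0 (Set.Ioi 0)) (nhds 0) := by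
    have hc : Continuous fun p : ℝ × ℝ => p.1 * m p := by fun_prop
    exact (hc.tendsto' (0, 0) 0 (by simp)).comp (hs.prodMk_nhds hl)
  have hlm : Tendsto (fun s => d₂ (s * m (s, d₁ (-s)))) (nhdsWithin 0 (Set.Ioi 0)) (nhds 0) :=
    hd₂.comp hm
  let F : ℝ × ℝ × ℝ → ℝ := fun p =>
    (-1 / 24 - p.2.1) + (1 / 6 + p.1 * (-1 / 24 - p.2.1)) / 2
      - p.1 * (1 / 6 + p.1 * (-1 / 24 - p.2.1)) ^ 2 / 2
      + m (p.1, p.2.1) ^ 3 / 3 + m (p.1, p.2.1) ^ 3 * p.2.2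
  have hF : Continuous F := by fun_prop
  refine ⟨fun s => F (s, d₁ (-s), d₂ (s * m (s, d₁ (-s)))),
    (hF.tendsto' (0, 0, 0) 0 (by norm_num [F, m])).comp
      (hs.prodMk_nhds (hl.prodMk_nhds hlm)), fun s hs0 => ?_⟩
  have h1 : (1 - exp (-s)) / s = 1 + s * m (s, d₁ (-s)) := by
    rw [hexp (-s)]
    simp only [Finset.sum_range_succ, Finset.sum_range_zero, Nat.factorial, m]
    field_simp
    push_cast
    ring
  rw [h1, hlog]
  simp only [F]
  generalize d₂ (s * m (s, d₁ (-s))) = δ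
  simp only [m]
  ring

/-- With `u = exp (a g)` and `t = s exp (-a g)`, where `g = log ((1 - exp (-s)) / s)`, the
third-order expansion of `u` in powers of `t` as `s → 0⁺`. -/
lemma tendsto_exp_mul_log_one_sub_exp_neg_div_expansion (a : ℝ) (v : ℝ → ℝ)
    (hv : ∀ s, v s = a * log ((1 - exp (-s)) / s)) :
    Tendsto (fun s => (exp (v s) - 1 + a / 2 * (s * exp (-v s))
        - (a / 24 + 3 * a ^ 2 / 8) * (s * exp (-v s)) ^ 2
        + (a ^ 2 / 12 + a ^ 3 / 3) * (s * exp (-v s)) ^ 3) / (s * exp (-v s)) ^ 3)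
      (nhdsWithin 0 (Set.Ioi 0)) (nhds 0) := by
  obtain ⟨e, he, hg⟩ := exists_log_one_sub_exp_neg_div_remainder
  obtain ⟨d₃, hd₃, h₃⟩ := exists_exp_taylor_remainder 3
  obtain ⟨d₂, hd₂, h₂⟩ := exists_exp_taylor_remainder 2
  obtain ⟨d₁, hd₁, h₁⟩ := exists_exp_taylor_remainder 1
  have hs : Tendsto (fun s : ℝ => s) (nhdsWithin 0 (Set.Ioi 0)) (nhds 0) :=
    tendsto_id.mono_left nhdsWithin_le_nhds
  let q : ℝ × ℝ → ℝ := fun p => a / 24 + p.1 * (a * p.2)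
  let r : ℝ × ℝ → ℝ := fun p => -a / 2 + p.1 * q p
  have hvr : ∀ s, 0 < s → v s = s * r (s, e s) := fun s hs0 => by
    rw [hv, hg s hs0]
    simp only [r, q]
    ring
  have hv0 : Tendsto v (nhdsWithin 0 (Set.Ioi 0)) (nhds 0) := by
    have hc : Continuous fun p : ℝ × ℝ => p.1 * r p := by fun_prop
    refine ((hc.tendsto' (0, 0) 0 (by simp)).comp (hs.prodMk_nhds he)).congr' ?_
    filter_upwards [self_mem_nhdsWithin] with s hs0 using (hvr s hs0).symm
  have hδ₃ : Tendsto (fun s => d₃ (v s)) (nhdsWithin 0 (Set.Ioi 0)) (nhds 0) := hd₃.comp hv0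
  have hδ₂ : Tendsto (fun s => d₂ (-v s)) (nhdsWithin 0 (Set.Ioi 0)) (nhds 0) :=
    hd₂.comp (by simpa using hv0.neg)
  have hδ₁ : Tendsto (fun s => d₁ (-(2 * v s))) (nhdsWithin 0 (Set.Ioi 0)) (nhds 0) :=
    hd₁.comp (by simpa using (hv0.const_mul 2).neg)
  let G : ℝ × ℝ × ℝ × ℝ × ℝ → ℝ := fun p =>
    a * p.2.1 - a * q (p.1, p.2.1) + p.1 * q (p.1, p.2.1) ^ 2 / 2 + r (p.1, p.2.1) ^ 3 / 6
      + r (p.1, p.2.1) ^ 3 * p.2.2.1 + a * r (p.1, p.2.1) ^ 2 / 4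
      + a / 2 * r (p.1, p.2.1) ^ 2 * p.2.2.2.1
      + (a / 24 + 3 * a ^ 2 / 8) * (2 * r (p.1, p.2.1) + 2 * r (p.1, p.2.1) * p.2.2.2.2)
  have hG : Tendsto (fun s => G (s, e s, d₃ (v s), d₂ (-v s), d₁ (-(2 * v s))))
      (nhdsWithin 0 (Set.Ioi 0)) (nhds (-(a ^ 2 / 12 + a ^ 3 / 3))) := by
    have hc : Continuous G := by fun_prop
    refine (hc.tendsto' (0, 0, 0, 0, 0) _ ?_).comp (hs.prodMk_nhds (he.prodMk_nhds
      (hδ₃.prodMk_nhds (hδ₂.prodMk_nhds hδ₁))))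
    simp only [G, q, r]
    ring
  have hexpv : Tendsto (fun s => exp (v s) ^ 3) (nhdsWithin 0 (Set.Ioi 0)) (nhds 1) := by
    simpa using ((continuous_exp.tendsto 0).comp hv0).pow 3
  have hlim := (hG.mul hexpv).add_const (a ^ 2 / 12 + a ^ 3 / 3)
  rw [mul_one, neg_add_cancel] at hlim
  refine hlim.congr' ?_
  filter_upwards [self_mem_nhdsWithin] with s hs0
  have hs0 : 0 < s := hs0
  have e3 := h₃ (v s)
  have e2 := h₂ (-v s)
  have e1 := h₁ (-(2 * v s))
  simp only [Finset.sum_range_succ, Finset.sum_range_zero, Nat.factorial] at e1 e2 e3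
  push_cast at e1 e2 e3
  have hsq : exp (-v s) ^ 2 = exp (-(2 * v s)) := by
    rw [← exp_nat_mul]
    push_cast
    ring_nf
  have hinv : exp (v s) ^ 3 * exp (-v s) ^ 3 = 1 := by
    rw [← mul_pow, ← exp_add, add_neg_cancel, exp_zero, one_pow]
  rw [eq_div_iff (by positivity)]
  have hE : exp (v s) - 1 + a / 2 * (s * exp (-v s))
        - (a / 24 + 3 * a ^ 2 / 8) * (s ^ 2 * exp (-v s) ^ 2)
      = s ^ 3 * G (s, e s, d₃ (v s), d₂ (-v s), d₁ (-(2 * v s))) := by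
    rw [hsq, e1, e2, e3]
    generalize d₁ (-(2 * v s)) = δ₁
    generalize d₂ (-v s) = δ₂
    generalize d₃ (v s) = δ₃
    rw [hvr s hs0]
    simp only [G, r, q]
    ring
  generalize G (s, e s, d₃ (v s), d₂ (-v s), d₁ (-(2 * v s))) = γ at hE ⊢
  linear_combination s ^ 3 * γ * hinv - hE

/-- Refined lower-tail expansion of the generalized Lambert function:
`y_β(x)·x^{-1/(β-1)} = 1 - t/(2(β-1)) + (β+8)t²/(24(β-1)²) - (β+3)t³/(12(β-1)³) + o(t³)`
as `x → 0⁺`, where `t = x^{β/(β-1)}`. -/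
theorem stmt_11 (beta : ℝ) (hbeta : 1 < beta)
    (yb : ℝ → ℝ)
    (hyb : ∀ x : ℝ, 0 < x → yb x ∈ Set.Ioo (0 : ℝ) 1 ∧
        (yb x) ^ beta = 1 - Real.exp (-(x * yb x)))
    (t : ℝ → ℝ) (ht : ∀ x : ℝ, t x = x ^ (beta / (beta - 1))) :
    Tendsto (fun x : ℝ =>
        (yb x * x ^ (-(1 / (beta - 1))) - 1 + t x / (2 * (beta - 1))
          - (beta + 8) * (t x) ^ 2 / (24 * (beta - 1) ^ 2)
          + (beta + 3) * (t x) ^ 3 / (12 * (beta - 1) ^ 3)) / (t x) ^ 3)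
      (nhdsWithin 0 (Set.Ioi 0)) (nhds 0) := by
  have hb : 0 < beta - 1 := by linarith
  have hb0 : beta - 1 ≠ 0 := hb.ne'
  have hs : Tendsto (fun x => x * yb x) (nhdsWithin 0 (Set.Ioi 0)) (nhdsWithin 0 (Set.Ioi 0)) := by
    refine tendsto_nhdsWithin_iff.mpr ⟨?_, ?_⟩
    · refine squeeze_zero' ?_ ?_ (tendsto_id.mono_left nhdsWithin_le_nhds)
      · filter_upwards [self_mem_nhdsWithin] with x hx
        exact mul_nonneg (le_of_lt hx) (hyb x hx).1.1.le
      · filter_upwards [self_mem_nhdsWithin] with x hx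
        exact mul_le_of_le_one_right (le_of_lt hx) (hyb x hx).1.2.le
    · filter_upwards [self_mem_nhdsWithin] with x hx
      exact mul_pos hx (hyb x hx).1.1
  refine ((tendsto_exp_mul_log_one_sub_exp_neg_div_expansion (1 / (beta - 1)) _
    fun s => rfl).comp hs).congr' ?_
  filter_upwards [self_mem_nhdsWithin] with x hx
  have hx : 0 < x := hx
  obtain ⟨⟨hy0, -⟩, hy⟩ := hyb x hx
  have hlog : log ((1 - exp (-(x * yb x))) / (x * yb x)) = (beta - 1) * log (yb x) - log x := by
    rw [← hy, log_div (by positivity) (by positivity), log_rpow hy0, log_mul hx.ne' hy0.ne']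
    ring
  have hu : yb x * x ^ (-(1 / (beta - 1)))
      = exp (1 / (beta - 1) * log ((1 - exp (-(x * yb x))) / (x * yb x))) := by
    rw [hlog, rpow_def_of_pos hx]
    nth_rewrite 1 [← exp_log hy0]
    rw [← exp_add]
    congr 1
    field_simp
    ring
  have htx : t x = x * yb x
      * exp (-(1 / (beta - 1) * log ((1 - exp (-(x * yb x))) / (x * yb x)))) := by
    rw [ht, hlog, rpow_def_of_pos hx]
    nth_rewrite 2 [← exp_log hx]
    nth_rewrite 1 [← exp_log hy0]
    rw [← exp_add, ← exp_add]
    congr 1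
    field_simp
    ring
  simp only [Function.comp]
  rw [← htx, ← hu]
  congr 1
  field_simp
  ring
end

section
/- Let β > 1. Then ∫₀¹ -log(1 - s^β)/s ds = π²/(6β). Equivalently, if y_β(x) is the unique y ∈ (0,1) with y^β = 1 - e^{-x·y}, then ∫₀^∞ (1 - y_β(x)) dx = π²/(6β); i.e., the expectation of the generalized Lambert random variable ξ_β equals ζ(2)/β. -/
open Real MeasureTheory

/-- The expansion of `-log(1-s^β)/s` in powers of `s`. -/
lemma hasSum_neg_log_one_sub_rpow_div {beta : ℝ} (hbeta : 0 < beta) {s : ℝ}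
    (hs : s ∈ Set.Ioo (0 : ℝ) 1) :
    HasSum (fun n : ℕ => s ^ (beta * (n + 1) - 1) / (n + 1)) (-Real.log (1 - s ^ beta) / s) := by
  have h0 : 0 < s ^ beta := rpow_pos_of_pos hs.1 _
  have h1 : s ^ beta < 1 := rpow_lt_one hs.1.le hs.2 hbeta
  have h := (Real.hasSum_pow_div_log_of_abs_lt_one
    (by rwa [abs_of_pos h0] : |s ^ beta| < 1)).div_const s
  refine h.congr_fun fun n => ?_
  rw [rpow_sub hs.1, rpow_one, rpow_mul hs.1.le]
  norm_cast
  rw [div_right_comm]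

lemma strictMonoOn_neg_log_one_sub_rpow_div {beta : ℝ} (hbeta : 1 < beta) :
    StrictMonoOn (fun s : ℝ => -Real.log (1 - s ^ beta) / s) (Set.Ioo 0 1) := by
  intro a ha b hb hab
  have hexp (n : ℕ) : 0 < beta * (n + 1) - 1 := by
    have : (0 : ℝ) ≤ n := n.cast_nonneg
    nlinarith
  have key (n : ℕ) : a ^ (beta * (n + 1) - 1) / (n + 1 : ℝ) < b ^ (beta * (n + 1) - 1) / (n + 1) :=
    div_lt_div_of_pos_right (rpow_lt_rpow ha.1.le hab (hexp n)) (by positivity)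
  exact hasSum_lt (fun n => (key n).le) (key 0)
    (hasSum_neg_log_one_sub_rpow_div (by linarith) ha)
    (hasSum_neg_log_one_sub_rpow_div (by linarith) hb)

lemma integral_neg_log_one_sub_rpow_div {beta : ℝ} (hbeta : 0 < beta) :
    (∫ s in Set.Ioo (0 : ℝ) 1, -Real.log (1 - s ^ beta) / s) = π ^ 2 / (6 * beta) := by
  have hexp (n : ℕ) : -1 < beta * (n + 1) - 1 := by
    have : 0 < beta * ((n : ℝ) + 1) := by positivity
    linarith
  have hint (n : ℕ) : Integrable (fun s : ℝ => s ^ (beta * (n + 1) - 1) / (n + 1))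
      (volume.restrict (Set.Ioo 0 1)) := by
    refine Integrable.div_const ?_ _
    exact (intervalIntegral.integrableOn_Ioo_rpow_iff zero_lt_one).2 (hexp n)
  have hval (n : ℕ) : ∫ s in Set.Ioo (0 : ℝ) 1, s ^ (beta * (n + 1) - 1) / (n + 1 : ℝ)
      = 1 / ((n + 1 : ℕ) : ℝ) ^ 2 / beta := by
    rw [← integral_Ioc_eq_integral_Ioo, ← intervalIntegral.integral_of_le zero_le_one,
      intervalIntegral.integral_div, integral_rpow (Or.inl (hexp n))]
    have : beta * ((n : ℝ) + 1) ≠ 0 := by positivity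
    rw [sub_add_cancel, one_rpow, zero_rpow this]
    push_cast
    field_simp
    ring
  have hnorm (n : ℕ) : ∫ s in Set.Ioo (0 : ℝ) 1, ‖s ^ (beta * (n + 1) - 1) / (n + 1 : ℝ)‖
      = 1 / ((n + 1 : ℕ) : ℝ) ^ 2 / beta := by
    rw [← hval n]
    refine setIntegral_congr_fun measurableSet_Ioo fun s hs => ?_
    exact Real.norm_of_nonneg (div_nonneg (rpow_nonneg hs.1.le _) (by positivity))
  have hzeta : HasSum (fun n : ℕ => 1 / ((n + 1 : ℕ) : ℝ) ^ 2 / beta) (π ^ 2 / 6 / beta) := by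
    refine HasSum.div_const ?_ _
    simpa using (hasSum_nat_add_iff' 1).2 hasSum_zeta_two
  have h := hasSum_integral_of_summable_integral_norm hint
    (by simpa only [hnorm] using hzeta.summable)
  simp only [hval] at h
  rw [← div_div, ← h.unique hzeta]
  exact setIntegral_congr_fun measurableSet_Ioo fun s hs =>
    (hasSum_neg_log_one_sub_rpow_div hbeta hs).tsum_eq.symm

/-- The expectation of the generalized Lambert random variable:
`∫₀¹ -log(1-s^β)/s ds = π²/(6β)`, equivalently `∫₀^∞ (1 - y_β(x)) dx = π²/(6β)`. -/
theorem stmt_13 (beta : ℝ) (hbeta : 1 < beta) :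
    (∫ s in Set.Ioo (0 : ℝ) 1, -Real.log (1 - s ^ beta) / s) = π ^ 2 / (6 * beta) ∧
    ∀ yb : ℝ → ℝ,
      (∀ x : ℝ, 0 < x → yb x ∈ Set.Ioo (0 : ℝ) 1 ∧
          (yb x) ^ beta = 1 - Real.exp (-(x * yb x))) →
      (∫ x in Set.Ioi (0 : ℝ), (1 - yb x)) = π ^ 2 / (6 * beta) := by
  have hpos : 0 < beta := zero_lt_one.trans hbeta
  have hval := integral_neg_log_one_sub_rpow_div hpos
  refine ⟨hval, fun yb hyb => ?_⟩
  have hint : Integrable (fun s : ℝ => -Real.log (1 - s ^ beta) / s)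
      (volume.restrict (Set.Ioo 0 1)) :=
    Integrable.of_integral_ne_zero (by rw [hval]; positivity)
  have hnonneg : 0 ≤ᵐ[volume.restrict (Set.Ioo (0 : ℝ) 1)]
      fun s => -Real.log (1 - s ^ beta) / s := by
    filter_upwards [ae_restrict_mem measurableSet_Ioo] with s hs
    exact (hasSum_neg_log_one_sub_rpow_div hpos hs).nonneg fun n =>
      div_nonneg (rpow_nonneg hs.1.le _) (by positivity)
  rw [← hval, hint.integral_eq_integral_meas_lt hnonneg]
  refine setIntegral_congr_fun measurableSet_Ioi fun x hx => ?_
  obtain ⟨hy, hyx⟩ := hyb x hx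
  have hx' : x = -Real.log (1 - yb x ^ beta) / yb x := by
    rw [hyx, sub_sub_cancel, Real.log_exp, neg_neg, mul_div_cancel_right₀ _ hy.1.ne']
  have hset : {s : ℝ | x < -Real.log (1 - s ^ beta) / s} ∩ Set.Ioo 0 1 = Set.Ioo (yb x) 1 := by
    ext s
    have hlt (hs : s ∈ Set.Ioo (0 : ℝ) 1) : x < -Real.log (1 - s ^ beta) / s ↔ yb x < s := by
      conv_lhs => rw [hx']
      exact (strictMonoOn_neg_log_one_sub_rpow_div hbeta).lt_iff_lt hy hs
    constructor
    · rintro ⟨h, hs⟩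
      exact ⟨(hlt hs).1 h, hs.2⟩
    · intro h
      have hs : s ∈ Set.Ioo (0 : ℝ) 1 := ⟨hy.1.trans h.1, h.2⟩
      exact ⟨(hlt hs).2 h.1, hs⟩
  rw [measureReal_restrict_apply' measurableSet_Ioo, hset, Real.volume_real_Ioo_of_le hy.2.le]
end

section
/- Let β > 1 and for integer n ≥ 1 define M_n = ∫₀¹ (-log(1 - s^β)/s)^n ds (the n-th moment of the generalized Lambert random variable ξ_β). Then 1/β ≤ liminf_{n→∞} M_n/n! ≤ limsup_{n→∞} M_n/n! ≤ 1/(β-1); in particular M_n grows like a constant c_β ∈ [1/β, 1/(β-1)] times n!. -/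
open Real MeasureTheory Filter

lemma image_exp_neg_Ioi_zero : (fun t : ℝ => Real.exp (-t)) '' Set.Ioi 0 = Set.Ioo 0 1 := by
  ext x
  constructor
  · rintro ⟨t, ht, rfl⟩
    exact ⟨Real.exp_pos _, Real.exp_lt_one_iff.mpr (neg_lt_zero.mpr ht)⟩
  · rintro ⟨h0, h1⟩
    refine ⟨-Real.log x, ?_, ?_⟩
    · simpa using Real.log_neg h0 h1
    · simp [Real.exp_log h0]

lemma hasDerivAt_exp_neg (t : ℝ) :
    HasDerivAt (fun t : ℝ => Real.exp (-t)) (-Real.exp (-t)) t := by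
  simpa using (hasDerivAt_neg t).exp

lemma injective_exp_neg : Function.Injective (fun t : ℝ => Real.exp (-t)) := fun x y h => by
  simpa using h

lemma exp_neg_smul_log_pow (n : ℕ) (t : ℝ) :
    |-Real.exp (-t)| • (-Real.log (Real.exp (-t))) ^ n
      = Real.exp (-t) * t ^ (((n : ℝ) + 1) - 1) := by
  simp [Real.abs_exp]

/-- The moments of a standard exponential variable, written on the unit interval. -/
lemma integral_neg_log_pow (n : ℕ) :
    ∫ x in Set.Ioo (0 : ℝ) 1, (-Real.log x) ^ n = n.factorial := by
  rw [← image_exp_neg_Ioi_zero, integral_image_eq_integral_abs_deriv_smul measurableSet_Ioi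
    (fun t _ => (hasDerivAt_exp_neg t).hasDerivWithinAt) injective_exp_neg.injOn]
  simp only [exp_neg_smul_log_pow]
  rw [← Real.Gamma_eq_integral (by positivity), Real.Gamma_nat_eq_factorial]

lemma integrableOn_neg_log_pow (n : ℕ) :
    IntegrableOn (fun x : ℝ => (-Real.log x) ^ n) (Set.Ioo 0 1) := by
  rw [← image_exp_neg_Ioi_zero, integrableOn_image_iff_integrableOn_abs_deriv_smul
    measurableSet_Ioi (fun t _ => (hasDerivAt_exp_neg t).hasDerivWithinAt)
    injective_exp_neg.injOn]
  simp only [exp_neg_smul_log_pow]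
  exact Real.GammaIntegral_convergent (by positivity)

lemma image_mul_one_sub_Ioo {κ : ℝ} (hκ : 0 < κ) :
    (fun s : ℝ => κ * (1 - s)) '' Set.Ioo (1 - 1 / κ) 1 = Set.Ioo 0 1 := by
  ext x
  constructor
  · rintro ⟨s, ⟨h0, h1⟩, rfl⟩
    refine ⟨mul_pos hκ (by linarith), ?_⟩
    calc κ * (1 - s) < κ * (1 / κ) := by gcongr; linarith
      _ = 1 := by field_simp
  · rintro ⟨h0, h1⟩
    refine ⟨1 - x / κ, ⟨?_, ?_⟩, ?_⟩
    · gcongr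
    · linarith [div_pos h0 hκ]
    · simp only; field_simp; ring

lemma hasDerivAt_mul_one_sub (κ s : ℝ) : HasDerivAt (fun s : ℝ => κ * (1 - s)) (-κ) s := by
  simpa using ((hasDerivAt_id s).const_sub 1).const_mul κ

lemma injective_mul_one_sub {κ : ℝ} (hκ : 0 < κ) :
    Function.Injective (fun s : ℝ => κ * (1 - s)) := fun x y h => by
  have := mul_left_cancel₀ hκ.ne' h
  linarith

lemma integral_neg_log_mul_one_sub_pow {κ : ℝ} (hκ : 0 < κ) (n : ℕ) :
    ∫ s in Set.Ioo (1 - 1 / κ) 1, (-Real.log (κ * (1 - s))) ^ n = n.factorial / κ := by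
  have h := integral_neg_log_pow n
  rw [← image_mul_one_sub_Ioo hκ, integral_image_eq_integral_abs_deriv_smul measurableSet_Ioo
    (fun t _ => (hasDerivAt_mul_one_sub κ t).hasDerivWithinAt)
    (injective_mul_one_sub hκ).injOn] at h
  simp only [abs_neg, abs_of_pos hκ, smul_eq_mul, integral_const_mul] at h
  rw [eq_div_iff hκ.ne', mul_comm, h]

lemma integrableOn_neg_log_mul_one_sub_pow {κ : ℝ} (hκ : 0 < κ) (n : ℕ) :
    IntegrableOn (fun s : ℝ => (-Real.log (κ * (1 - s))) ^ n) (Set.Ioo (1 - 1 / κ) 1) := by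
  have h := integrableOn_neg_log_pow n
  rw [← image_mul_one_sub_Ioo hκ, integrableOn_image_iff_integrableOn_abs_deriv_smul
    measurableSet_Ioo (fun t _ => (hasDerivAt_mul_one_sub κ t).hasDerivWithinAt)
    (injective_mul_one_sub hκ).injOn] at h
  simp only [abs_neg, abs_of_pos hκ, smul_eq_mul] at h
  exact (integrable_const_mul_iff hκ.ne'.isUnit _).mp h

lemma neg_log_mul_one_sub_nonneg {κ s : ℝ} (hκ : 0 < κ) (hs : s ∈ Set.Ioo (1 - 1 / κ) 1) :
    0 ≤ -Real.log (κ * (1 - s)) := by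
  have h : κ * (1 - s) ∈ Set.Ioo (0 : ℝ) 1 :=
    image_mul_one_sub_Ioo hκ ▸ Set.mem_image_of_mem (fun s : ℝ => κ * (1 - s)) hs
  exact neg_nonneg.mpr (Real.log_nonpos h.1.le h.2.le)

section Lambert

variable {β s : ℝ}

lemma rpow_lt_one_of_mem_Ioo (hβ : 1 < β) (hs : s ∈ Set.Ioo (0 : ℝ) 1) : s ^ β < 1 :=
  Real.rpow_lt_one hs.1.le hs.2 (by linarith)

lemma neg_log_one_sub_rpow_nonneg (hβ : 1 < β) (hs : s ∈ Set.Ioo (0 : ℝ) 1) :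
    0 ≤ -Real.log (1 - s ^ β) :=
  neg_nonneg.mpr (Real.log_nonpos (by linarith [rpow_lt_one_of_mem_Ioo hβ hs])
    (by linarith [Real.rpow_nonneg hs.1.le β]))

lemma lambert_nonneg (hβ : 1 < β) (hs : s ∈ Set.Ioo (0 : ℝ) 1) :
    0 ≤ -Real.log (1 - s ^ β) / s :=
  div_nonneg (neg_log_one_sub_rpow_nonneg hβ hs) hs.1.le

lemma lambert_le_inv_one_sub (hβ : 1 < β) (hs : s ∈ Set.Ioo (0 : ℝ) 1) :
    -Real.log (1 - s ^ β) / s ≤ (1 - s)⁻¹ := by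
  have hpos : 0 < 1 - s := by linarith [hs.2]
  have hle : s ^ β ≤ s := by
    simpa using Real.rpow_le_rpow_of_exponent_ge hs.1 hs.2.le hβ.le
  have h1 : Real.log (1 - s) ≤ Real.log (1 - s ^ β) := Real.log_le_log hpos (by linarith)
  have h2 := Real.one_sub_inv_le_log_of_pos hpos
  rw [div_le_iff₀ hs.1]
  calc -Real.log (1 - s ^ β) ≤ (1 - s)⁻¹ - 1 := by linarith
    _ = (1 - s)⁻¹ * s := by field_simp; ring

lemma neg_log_mul_one_sub_le_lambert (hβ : 1 < β) (hs : s ∈ Set.Ioo (0 : ℝ) 1) :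
    -Real.log (β * (1 - s)) ≤ -Real.log (1 - s ^ β) / s := by
  have hbern : 1 - s ^ β ≤ β * (1 - s) := by
    have := one_add_mul_self_le_rpow_one_add (s := s - 1) (by linarith [hs.1]) hβ.le
    rw [add_sub_cancel] at this
    linarith
  have hlog := Real.log_le_log (by linarith [rpow_lt_one_of_mem_Ioo hβ hs]) hbern
  calc -Real.log (β * (1 - s)) ≤ -Real.log (1 - s ^ β) := by linarith
    _ ≤ -Real.log (1 - s ^ β) / s :=
      le_div_self (neg_log_one_sub_rpow_nonneg hβ hs) hs.1 hs.2.le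

open Topology in
lemma tendsto_one_sub_rpow_div (β : ℝ) :
    Tendsto (fun s : ℝ => (1 - s ^ β) / (1 - s)) (𝓝[<] 1) (𝓝 β) := by
  have h := (Real.hasDerivAt_rpow_const (x := 1) (p := β) (Or.inl one_ne_zero)).tendsto_slope
  rw [Real.one_rpow, mul_one] at h
  refine (h.mono_left (nhdsWithin_mono _ fun s hs => ne_of_lt hs)).congr fun s => ?_
  rw [slope_def_field, Real.one_rpow, ← neg_div_neg_eq, neg_sub, neg_sub]

open Topology in
/-- Near `1`, the generalized Lambert function behaves like `-log (β (1 - s))`. -/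
lemma tendsto_exp_neg_lambert_div (hβ : 1 < β) :
    Tendsto (fun s : ℝ => Real.exp (-(-Real.log (1 - s ^ β) / s)) / (1 - s))
      (𝓝[<] 1) (𝓝 β) := by
  have hslope := tendsto_one_sub_rpow_div β
  have hid : Tendsto (fun s : ℝ => s) (𝓝[<] 1) (𝓝 1) := tendsto_id.mono_left nhdsWithin_le_nhds
  have hsub : Tendsto (fun s : ℝ => 1 - s ^ β) (𝓝[<] 1) (𝓝 0) := by
    simpa using (hid.rpow_const (p := β) (Or.inl one_ne_zero)).const_sub 1
  have hxlog : Tendsto (fun s : ℝ => (1 - s ^ β) * Real.log (1 - s ^ β)) (𝓝[<] 1) (𝓝 0) := by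
    simpa [Function.comp_def] using (Real.continuous_mul_log.tendsto 0).comp hsub
  have herr := ((hxlog.div hslope (by linarith)).div hid one_ne_zero).rexp
  have hlim := hslope.mul herr
  rw [zero_div, zero_div, Real.exp_zero, mul_one] at hlim
  refine hlim.congr' ?_
  filter_upwards [Ioo_mem_nhdsLT (zero_lt_one' ℝ)] with s hs
  have hpos : 0 < 1 - s ^ β := by linarith [rpow_lt_one_of_mem_Ioo hβ hs]
  have hs0 : s ≠ 0 := hs.1.ne'
  have hs1 : 1 - s ≠ 0 := by linarith [hs.2]
  have hsplit : -(-Real.log (1 - s ^ β) / s) = Real.log (1 - s ^ β) +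
      (1 - s ^ β) * Real.log (1 - s ^ β) / ((1 - s ^ β) / (1 - s)) / s := by
    have := hpos.ne'
    generalize 1 - s ^ β = u at *
    field_simp
    ring
  rw [hsplit, Real.exp_add, Real.exp_log hpos]
  simp only [Pi.div_apply]
  ring

lemma exists_lambert_le {κ : ℝ} (hβ : 1 < β) (hκ : 0 < κ) (hκβ : κ < β) :
    ∃ a ∈ Set.Ioo (0 : ℝ) 1, 1 - 1 / κ ≤ a ∧ ∀ s ∈ Set.Ioo a 1,
      -Real.log (1 - s ^ β) / s ≤ -Real.log (κ * (1 - s)) := by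
  have hev := (tendsto_exp_neg_lambert_div hβ).eventually (lt_mem_nhds hκβ)
  obtain ⟨l, hl, hsub⟩ := (mem_nhdsLT_iff_exists_Ioo_subset).mp hev
  refine ⟨max l (max (1 / 2) (1 - 1 / κ)), ⟨?_, ?_⟩, ?_, ?_⟩
  · exact lt_max_of_lt_right (lt_max_of_lt_left (by norm_num))
  · exact max_lt hl (max_lt (by norm_num) (by linarith [one_div_pos.mpr hκ]))
  · exact (le_max_right _ _).trans (le_max_right _ _)
  · intro s hs
    have hs1 : 0 < 1 - s := by linarith [hs.2]
    have h : κ < Real.exp (-(-Real.log (1 - s ^ β) / s)) / (1 - s) :=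
      hsub ⟨(le_max_left _ _).trans_lt hs.1, hs.2⟩
    rw [lt_div_iff₀ hs1] at h
    have := Real.log_le_log (mul_pos hκ hs1) h.le
    rw [Real.log_exp] at this
    linarith

lemma measurable_lambert_pow (β : ℝ) (n : ℕ) :
    Measurable (fun s : ℝ => (-Real.log (1 - s ^ β) / s) ^ n) := by
  fun_prop

/-- The moments of the generalized Lambert variable are finite and at most
`n! / κ` up to an exponential term, for every `κ < β`. -/
lemma exists_lambert_moment_le {κ : ℝ} (hβ : 1 < β) (hκ : 0 < κ) (hκβ : κ < β) :
    ∃ C : ℝ, ∀ n : ℕ,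
      IntegrableOn (fun s : ℝ => (-Real.log (1 - s ^ β) / s) ^ n) (Set.Ioo 0 1) ∧
      ∫ s in Set.Ioo (0 : ℝ) 1, (-Real.log (1 - s ^ β) / s) ^ n ≤ C ^ n + n.factorial / κ := by
  obtain ⟨a, ⟨ha0, ha1⟩, haκ, hle⟩ := exists_lambert_le hβ hκ hκβ
  refine ⟨(1 - a)⁻¹, fun n => ?_⟩
  have hunion : Set.Ioo (0 : ℝ) 1 = Set.Ioc 0 a ∪ Set.Ioo a 1 :=
    (Set.Ioc_union_Ioo_eq_Ioo ha0.le ha1).symm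
  have hdisj : Disjoint (Set.Ioc 0 a) (Set.Ioo a 1) :=
    Set.disjoint_left.mpr fun s hs hs' => not_lt.mpr hs.2 hs'.1
  have hsubset : Set.Ioo a 1 ⊆ Set.Ioo (1 - 1 / κ) 1 := Set.Ioo_subset_Ioo_left haκ
  have hmeas := (measurable_lambert_pow β n).aestronglyMeasurable (μ := volume)
  have hleft : ∀ s ∈ Set.Ioc 0 a, 0 ≤ (-Real.log (1 - s ^ β) / s) ^ n ∧
      (-Real.log (1 - s ^ β) / s) ^ n ≤ (1 - a)⁻¹ ^ n := fun s hs => by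
    have hs' : s ∈ Set.Ioo (0 : ℝ) 1 := ⟨hs.1, hs.2.trans_lt ha1⟩
    have h0 := lambert_nonneg hβ hs'
    refine ⟨pow_nonneg h0 n, pow_le_pow_left₀ h0 ?_ n⟩
    exact (lambert_le_inv_one_sub hβ hs').trans
      (inv_anti₀ (by linarith) (by linarith [hs.2]))
  have hright : ∀ s ∈ Set.Ioo a 1, 0 ≤ (-Real.log (1 - s ^ β) / s) ^ n ∧
      (-Real.log (1 - s ^ β) / s) ^ n ≤ (-Real.log (κ * (1 - s))) ^ n := fun s hs => by
    have h0 := lambert_nonneg hβ ⟨ha0.trans hs.1, hs.2⟩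
    exact ⟨pow_nonneg h0 n, pow_le_pow_left₀ h0 (hle s hs) n⟩
  have hconst : IntegrableOn (fun _ : ℝ => (1 - a)⁻¹ ^ n) (Set.Ioc 0 a) :=
    integrableOn_const (by simp)
  have hlog := integrableOn_neg_log_mul_one_sub_pow hκ n
  have hintl : IntegrableOn (fun s : ℝ => (-Real.log (1 - s ^ β) / s) ^ n) (Set.Ioc 0 a) := by
    refine hconst.mono' hmeas.restrict ((ae_restrict_iff' measurableSet_Ioc).mpr
      (ae_of_all _ fun s hs => ?_))
    rw [Real.norm_of_nonneg (hleft s hs).1]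
    exact (hleft s hs).2
  have hintr : IntegrableOn (fun s : ℝ => (-Real.log (1 - s ^ β) / s) ^ n) (Set.Ioo a 1) := by
    refine (hlog.mono_set hsubset).mono' hmeas.restrict
      ((ae_restrict_iff' measurableSet_Ioo).mpr (ae_of_all _ fun s hs => ?_))
    rw [Real.norm_of_nonneg (hright s hs).1]
    exact (hright s hs).2
  refine ⟨hunion ▸ hintl.union hintr, ?_⟩
  rw [hunion, setIntegral_union hdisj measurableSet_Ioo hintl hintr]
  refine add_le_add ?_ ?_
  · calc ∫ s in Set.Ioc 0 a, (-Real.log (1 - s ^ β) / s) ^ n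
        ≤ ∫ _ in Set.Ioc 0 a, (1 - a)⁻¹ ^ n :=
          setIntegral_mono_on hintl hconst measurableSet_Ioc fun s hs => (hleft s hs).2
      _ = a * (1 - a)⁻¹ ^ n := by simp [ha0.le]
      _ ≤ (1 - a)⁻¹ ^ n := mul_le_of_le_one_left
          (pow_nonneg (inv_nonneg.mpr (by linarith)) n) ha1.le
  · calc ∫ s in Set.Ioo a 1, (-Real.log (1 - s ^ β) / s) ^ n
        ≤ ∫ s in Set.Ioo a 1, (-Real.log (κ * (1 - s))) ^ n :=
          setIntegral_mono_on hintr (hlog.mono_set hsubset) measurableSet_Ioo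
            fun s hs => (hright s hs).2
      _ ≤ ∫ s in Set.Ioo (1 - 1 / κ) 1, (-Real.log (κ * (1 - s))) ^ n :=
          setIntegral_mono_set hlog ((ae_restrict_iff' measurableSet_Ioo).mpr
            (ae_of_all _ fun s hs => pow_nonneg (neg_log_mul_one_sub_nonneg hκ hs) n))
            hsubset.eventuallyLE
      _ = n.factorial / κ := integral_neg_log_mul_one_sub_pow hκ n

lemma le_lambert_moment (hβ : 1 < β) {n : ℕ}
    (hint : IntegrableOn (fun s : ℝ => (-Real.log (1 - s ^ β) / s) ^ n) (Set.Ioo 0 1)) :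
    n.factorial / β ≤ ∫ s in Set.Ioo (0 : ℝ) 1, (-Real.log (1 - s ^ β) / s) ^ n := by
  have hβ0 : 0 < β := by linarith
  have hsubset : Set.Ioo (1 - 1 / β) 1 ⊆ Set.Ioo (0 : ℝ) 1 :=
    Set.Ioo_subset_Ioo_left (by linarith [(div_lt_one hβ0).mpr hβ])
  calc (n.factorial : ℝ) / β
      = ∫ s in Set.Ioo (1 - 1 / β) 1, (-Real.log (β * (1 - s))) ^ n :=
        (integral_neg_log_mul_one_sub_pow hβ0 n).symm
    _ ≤ ∫ s in Set.Ioo (1 - 1 / β) 1, (-Real.log (1 - s ^ β) / s) ^ n :=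
        setIntegral_mono_on (integrableOn_neg_log_mul_one_sub_pow hβ0 n) (hint.mono_set hsubset)
          measurableSet_Ioo fun s hs => pow_le_pow_left₀ (neg_log_mul_one_sub_nonneg hβ0 hs)
            (neg_log_mul_one_sub_le_lambert hβ (hsubset hs)) n
    _ ≤ ∫ s in Set.Ioo (0 : ℝ) 1, (-Real.log (1 - s ^ β) / s) ^ n :=
        setIntegral_mono_set hint ((ae_restrict_iff' measurableSet_Ioo).mpr
          (ae_of_all _ fun s hs => pow_nonneg (lambert_nonneg hβ hs) n)) hsubset.eventuallyLE

end Lambert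

/-- Growth of moments: with `M_n = ∫₀¹ (-log(1-s^β)/s)^n ds`,
`1/β ≤ liminf M_n/n! ≤ limsup M_n/n! ≤ 1/(β-1)`. -/
theorem stmt_15 (beta : ℝ) (hbeta : 1 < beta)
    (M : ℕ → ℝ)
    (hM : ∀ n : ℕ, M n = ∫ s in Set.Ioo (0 : ℝ) 1, (-Real.log (1 - s ^ beta) / s) ^ n) :
    1 / beta ≤ liminf (fun n : ℕ => M n / (n.factorial : ℝ)) atTop ∧
    liminf (fun n : ℕ => M n / (n.factorial : ℝ)) atTop ≤
      limsup (fun n : ℕ => M n / (n.factorial : ℝ)) atTop ∧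
    limsup (fun n : ℕ => M n / (n.factorial : ℝ)) atTop ≤ 1 / (beta - 1) := by
  obtain ⟨C, hC⟩ := exists_lambert_moment_le hbeta (sub_pos.mpr hbeta) (sub_one_lt beta)
  have hfac : ∀ n : ℕ, (0 : ℝ) < n.factorial := fun n => by positivity
  have hlower : ∀ n : ℕ, 1 / beta ≤ M n / (n.factorial : ℝ) := fun n => by
    rw [le_div_iff₀ (hfac n), hM, one_div_mul_eq_div]
    exact le_lambert_moment hbeta (hC n).1
  have hupper : ∀ n : ℕ, M n / (n.factorial : ℝ) ≤ C ^ n / n.factorial + 1 / (beta - 1) :=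
    fun n => by
      rw [div_le_iff₀ (hfac n), add_mul, div_mul_cancel₀ _ (hfac n).ne', one_div_mul_eq_div, hM]
      exact (hC n).2
  have hlim : Tendsto (fun n : ℕ => C ^ n / n.factorial + 1 / (beta - 1)) atTop
      (nhds (1 / (beta - 1))) := by
    simpa using (FloorSemiring.tendsto_pow_div_factorial_atTop C).add_const (1 / (beta - 1))
  have hbddBelow : IsBoundedUnder (· ≥ ·) atTop (fun n : ℕ => M n / (n.factorial : ℝ)) :=
    isBoundedUnder_of ⟨1 / beta, hlower⟩
  have hbddAbove : IsBoundedUnder (· ≤ ·) atTop (fun n : ℕ => M n / (n.factorial : ℝ)) :=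
    hlim.isBoundedUnder_le.mono_le (Eventually.of_forall hupper)
  refine ⟨?_, liminf_le_limsup hbddAbove hbddBelow, ?_⟩
  · exact le_liminf_of_le hbddAbove.isCoboundedUnder_ge (Eventually.of_forall hlower)
  · rw [← hlim.limsup_eq]
    exact limsup_le_limsup (Eventually.of_forall hupper) hbddBelow.isCoboundedUnder_le
      hlim.isBoundedUnder_le
end

section
/- Let β > 1 and for integer n ≥ 0 define M_n = ∫₀¹ (-log(1 - s^β)/s)^n ds (with M_0 = 1). If μ and ν are probability measures on ℝ, each supported on [0, ∞), such that ∫ x^n dμ(x) = M_n and ∫ x^n dν(x) = M_n for all integers n ≥ 0, then μ = ν. That is, the moment problem for the generalized Lambert distribution is determinate. -/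
open Real MeasureTheory
open ProbabilityTheory Filter Topology

/-- A finite measure with finite exponential moments around `0` is determined by its moments. -/
lemma eq_of_forall_integral_pow_eq {μ ν : Measure ℝ} [IsFiniteMeasure μ] [IsFiniteMeasure ν]
    (hμ : 0 ∈ interior (integrableExpSet id μ)) (hν : 0 ∈ interior (integrableExpSet id ν))
    (h : ∀ n : ℕ, ∫ x, x ^ n ∂μ = ∫ x, x ^ n ∂ν) : μ = ν := by
  have hder (n : ℕ) :
      iteratedDeriv n (complexMGF id μ) 0 = iteratedDeriv n (complexMGF id ν) 0 := by
    rw [iteratedDeriv_complexMGF (by simpa using hμ), iteratedDeriv_complexMGF (by simpa using hν)]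
    simp only [id_eq, zero_mul, Complex.exp_zero, mul_one]
    have hcast (ρ : Measure ℝ) : ∫ x : ℝ, (x : ℂ) ^ n ∂ρ = ((∫ x, x ^ n ∂ρ : ℝ) : ℂ) := by
      rw [← integral_complex_ofReal]
      simp
    rw [hcast, hcast, h]
  have hpμ := (analyticAt_complexMGF (X := id) (μ := μ) (z := 0)
    (by simpa using hμ)).hasFPowerSeriesAt
  have hpν := (analyticAt_complexMGF (X := id) (μ := ν) (z := 0)
    (by simpa using hν)).hasFPowerSeriesAt
  simp_rw [← hder] at hpν
  have hloc : complexMGF id μ =ᶠ[𝓝 0] complexMGF id ν := by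
    filter_upwards [hpμ.eventually_hasSum_sub, hpν.eventually_hasSum_sub] with z h₁ h₂
      using h₁.unique h₂
  set U : Set ℝ := interior (integrableExpSet id μ) ∩ interior (integrableExpSet id ν)
  have hU : Convex ℝ U := convex_integrableExpSet.interior.inter convex_integrableExpSet.interior
  have hEq : Set.EqOn (complexMGF id μ) (complexMGF id ν) {z | z.re ∈ U} :=
    (analyticOnNhd_complexMGF.mono fun z hz ↦ hz.1).eqOn_of_preconnected_of_eventuallyEq
      (analyticOnNhd_complexMGF.mono fun z hz ↦ hz.2)
      (hU.linear_preimage Complex.reLm).isPreconnected (z₀ := 0) (by simpa [U] using ⟨hμ, hν⟩) hloc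
  refine Measure.ext_of_charFun (funext fun t ↦ ?_)
  rw [← complexMGF_id_mul_I, ← complexMGF_id_mul_I]
  exact hEq (by simpa [U] using ⟨hμ, hν⟩)

/-- A measure on `[0, ∞)` whose `n`-th moments are at most `K * n! * R ^ n` has finite exponential
moments of every order `t < 1 / R`. -/
lemma integrable_exp_mul_of_moment_le {μ : Measure ℝ} (hμ0 : μ (Set.Iio 0) = 0)
    (hint : ∀ n : ℕ, Integrable (fun x : ℝ ↦ x ^ n) μ) {K R t : ℝ} (hR : 0 ≤ R) (ht : 0 ≤ t)
    (htR : t * R < 1) (hle : ∀ n : ℕ, ∫ x, x ^ n ∂μ ≤ K * n.factorial * R ^ n) :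
    Integrable (fun x ↦ exp (t * x)) μ := by
  have hnonneg : ∀ᵐ x ∂μ, 0 ≤ x := by
    rw [ae_iff]
    simpa [Set.Iio] using hμ0
  have hterm : ∀ n : ℕ, ∀ᵐ x ∂μ, 0 ≤ (t * x) ^ n / n.factorial := fun n ↦ by
    filter_upwards [hnonneg] with x hx
    positivity
  have hterm_int (n : ℕ) : Integrable (fun x ↦ (t * x) ^ n / n.factorial) μ := by
    simpa only [mul_pow] using ((hint n).const_mul (t ^ n)).div_const _
  have hgeom : Summable fun n : ℕ ↦ K * (t * R) ^ n :=
    (summable_geometric_of_lt_one (by positivity) htR).mul_left K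
  rw [← lintegral_ofReal_ne_top_iff_integrable (by fun_prop) (ae_of_all _ fun x ↦ (exp_pos _).le)]
  have hexp : ∫⁻ x, ENNReal.ofReal (exp (t * x)) ∂μ =
      ∑' n : ℕ, ENNReal.ofReal (∫ x, (t * x) ^ n / n.factorial ∂μ) := by
    simp_rw [fun n : ℕ ↦ ofReal_integral_eq_lintegral_ofReal (hterm_int n) (hterm n)]
    rw [← lintegral_tsum fun n ↦ by fun_prop]
    refine lintegral_congr_ae ?_
    filter_upwards [hnonneg] with x hx
    have hs := NormedSpace.expSeries_div_hasSum_exp (t * x)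
    rw [← Real.exp_eq_exp_ℝ] at hs
    rw [← ENNReal.ofReal_tsum_of_nonneg (fun n ↦ by positivity) hs.summable, hs.tsum_eq]
  rw [hexp]
  refine ne_top_of_le_ne_top hgeom.tsum_ofReal_ne_top (ENNReal.tsum_le_tsum fun n ↦ ?_)
  refine ENNReal.ofReal_le_ofReal ?_
  simp_rw [mul_pow, integral_div, integral_const_mul]
  rw [div_le_iff₀ (by positivity)]
  calc t ^ n * ∫ x, x ^ n ∂μ ≤ t ^ n * (K * n.factorial * R ^ n) := by gcongr; exact hle n
    _ = K * (t ^ n * R ^ n) * n.factorial := by ring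

/-- If the variable is almost everywhere nonnegative, one positive exponential moment suffices for
`0` to be interior to the domain of the moment generating function. -/
lemma zero_mem_interior_integrableExpSet {μ : Measure ℝ} [IsFiniteMeasure μ]
    (hμ0 : μ (Set.Iio 0) = 0) {t : ℝ} (ht : 0 < t) (h : Integrable (fun x ↦ exp (t * x)) μ) :
    0 ∈ interior (integrableExpSet id μ) := by
  have hnonneg : ∀ᵐ x ∂μ, 0 ≤ x := by
    rw [ae_iff]
    simpa [Set.Iio] using hμ0
  refine mem_interior_iff_mem_nhds.2 (mem_of_superset (Iio_mem_nhds ht) fun u hu ↦ ?_)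
  refine h.mono' (by fun_prop) ?_
  filter_upwards [hnonneg] with x hx
  rw [norm_of_nonneg (exp_pos _).le]
  exact exp_le_exp.2 (mul_le_mul_of_nonneg_right (Set.mem_Iio.1 hu).le hx)

lemma neg_log_one_sub_rpow_div_nonneg {beta s : ℝ} (hbeta : 1 < beta) (hs : s ∈ Set.Ioo (0 : ℝ) 1) :
    0 ≤ -log (1 - s ^ beta) / s := by
  have h0 : 0 < s ^ beta := rpow_pos_of_pos hs.1 _
  have h1 : s ^ beta < 1 := rpow_lt_one hs.1.le hs.2 (by linarith)
  exact div_nonneg (neg_nonneg.2 (log_nonpos (by linarith) (by linarith))) hs.1.le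

lemma neg_log_one_sub_rpow_div_le {beta s : ℝ} (hbeta : 1 < beta) (hs : s ∈ Set.Ioo (0 : ℝ) 1) :
    -log (1 - s ^ beta) / s ≤ 2 - 2 * log (1 - s) := by
  obtain ⟨hs0, hs1⟩ := hs
  have hle : s ^ beta ≤ s := by
    simpa using rpow_le_rpow_of_exponent_ge hs0 hs1.le hbeta.le
  have hlog : -log (1 - s ^ beta) ≤ -log (1 - s) :=
    neg_le_neg (log_le_log (by linarith) (by linarith))
  have hneg : log (1 - s) ≤ 0 := log_nonpos (by linarith) (by linarith)
  rw [div_le_iff₀ hs0]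
  rcases le_total s (1 / 2) with h | h
  · have h1 := one_sub_inv_le_log_of_pos (show 0 < 1 - s by linarith)
    have h2 : (1 - s)⁻¹ ≤ 1 + 2 * s := by
      rw [inv_le_iff_one_le_mul₀ (by linarith)]
      nlinarith
    nlinarith
  · nlinarith

lemma integrableOn_one_sub_rpow_neg_half :
    IntegrableOn (fun s : ℝ ↦ (1 - s) ^ (-(1 / 2) : ℝ)) (Set.Ioo 0 1) := by
  have h := (intervalIntegral.intervalIntegrable_rpow' (a := 0) (b := 1)
    (r := -(1 / 2)) (by norm_num)).comp_sub_left 1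
  simp only [sub_zero, sub_self] at h
  exact (intervalIntegrable_iff_integrableOn_Ioo_of_le zero_le_one).1 h.symm

lemma integral_neg_log_one_sub_rpow_div_pow_le {beta : ℝ} (hbeta : 1 < beta) (n : ℕ) :
    ∫ s in Set.Ioo (0 : ℝ) 1, (-log (1 - s ^ beta) / s) ^ n ≤
      (exp (1 / 2) * ∫ s in Set.Ioo (0 : ℝ) 1, (1 - s) ^ (-(1 / 2) : ℝ)) * n.factorial * 4 ^ n := by
  calc ∫ s in Set.Ioo (0 : ℝ) 1, (-log (1 - s ^ beta) / s) ^ n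
      ≤ ∫ s in Set.Ioo (0 : ℝ) 1,
          (exp (1 / 2) * n.factorial * 4 ^ n) * (1 - s) ^ (-(1 / 2) : ℝ) := by
        refine integral_mono_of_nonneg ?_ (integrableOn_one_sub_rpow_neg_half.const_mul _) ?_
        · filter_upwards [ae_restrict_mem measurableSet_Ioo] with s hs
          exact pow_nonneg (neg_log_one_sub_rpow_div_nonneg hbeta hs) n
        · filter_upwards [ae_restrict_mem measurableSet_Ioo] with s hs
          have hg := neg_log_one_sub_rpow_div_nonneg hbeta hs
          have hg' := neg_log_one_sub_rpow_div_le hbeta hs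
          set g := -log (1 - s ^ beta) / s
          have hpow := pow_div_factorial_le_exp (g / 4) (by positivity) n
          rw [div_le_iff₀ (by positivity), div_pow, div_le_iff₀ (by positivity)] at hpow
          have hexp : exp (g / 4) ≤ exp (1 / 2) * (1 - s) ^ (-(1 / 2) : ℝ) := by
            rw [rpow_def_of_pos (by linarith [hs.2]), ← exp_add]
            exact exp_le_exp.2 (by linarith)
          calc g ^ n ≤ exp (g / 4) * n.factorial * 4 ^ n := hpow
            _ ≤ (exp (1 / 2) * (1 - s) ^ (-(1 / 2) : ℝ)) * n.factorial * 4 ^ n := by gcongr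
            _ = _ := by ring
    _ = _ := by rw [integral_const_mul]; ring

/-- Determinacy of the moment problem: any two probability measures on `[0,∞)` having
the moments `M_n = ∫₀¹ (-log(1-s^β)/s)^n ds` of the generalized Lambert distribution
coincide. -/
theorem stmt_16 (beta : ℝ) (hbeta : 1 < beta)
    (M : ℕ → ℝ)
    (hM : ∀ n : ℕ, M n = ∫ s in Set.Ioo (0 : ℝ) 1, (-Real.log (1 - s ^ beta) / s) ^ n)
    (μ ν : Measure ℝ)
    (hμp : IsProbabilityMeasure μ) (hνp : IsProbabilityMeasure ν)
    (hμ0 : μ (Set.Iio 0) = 0) (hν0 : ν (Set.Iio 0) = 0)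
    (hμint : ∀ n : ℕ, Integrable (fun x : ℝ => x ^ n) μ)
    (hνint : ∀ n : ℕ, Integrable (fun x : ℝ => x ^ n) ν)
    (hμM : ∀ n : ℕ, (∫ x, x ^ n ∂μ) = M n)
    (hνM : ∀ n : ℕ, (∫ x, x ^ n ∂ν) = M n) :
    μ = ν := by
  have hexp (ρ : Measure ℝ) [IsProbabilityMeasure ρ] (h0 : ρ (Set.Iio 0) = 0)
      (hint : ∀ n : ℕ, Integrable (fun x : ℝ => x ^ n) ρ) (hρM : ∀ n : ℕ, (∫ x, x ^ n ∂ρ) = M n) :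
      0 ∈ interior (integrableExpSet id ρ) :=
    zero_mem_interior_integrableExpSet h0 (t := 1 / 8) (by norm_num) <|
      integrable_exp_mul_of_moment_le h0 hint (R := 4) (by norm_num) (by norm_num) (by norm_num)
        fun n ↦ (hρM n).trans_le <| (hM n).trans_le <|
          integral_neg_log_one_sub_rpow_div_pow_le hbeta n
  exact eq_of_forall_integral_pow_eq (hexp μ hμ0 hμint hμM) (hexp ν hν0 hνint hνM)
    fun n ↦ (hμM n).trans (hνM n).symm
end

section
/- Let 0 < α < 1. Then ∫₀¹ t^{-1-α} · (log(1 - t))² dt = Σ_{k=1}^∞ Σ_{m=1}^∞ 1/(k · m · (k + m - α)), where the double series converges. -/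
open Real MeasureTheory

theorem summable_tornheim {α : ℝ} (hα : α ≤ 1) :
    Summable (fun p : ℕ+ × ℕ+ =>
      1 / (((p.1 : ℕ) : ℝ) * ((p.2 : ℕ) : ℝ) *
        (((p.1 : ℕ) : ℝ) + ((p.2 : ℕ) : ℝ) - α))) := by
  have h1 : Summable (fun n : ℕ+ => 1 / ((n : ℕ) : ℝ) ^ (3 / 2 : ℝ)) :=
    (Real.summable_one_div_nat_rpow.2 (by norm_num : (1 : ℝ) < 3 / 2)).comp_injective
      PNat.coe_injective
  have h2 := h1.mul_of_nonneg h1 (fun n => by positivity) (fun n => by positivity)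
  refine Summable.of_nonneg_of_le (fun p => ?_) (fun p => ?_) h2
  all_goals
    have hk : (1 : ℝ) ≤ ((p.1 : ℕ) : ℝ) := by exact_mod_cast p.1.pos
    have hm : (1 : ℝ) ≤ ((p.2 : ℕ) : ℝ) := by exact_mod_cast p.2.pos
    generalize ((p.1 : ℕ) : ℝ) = k at *
    generalize ((p.2 : ℕ) : ℝ) = m at *
    have hk0 : 0 < k := by linarith
    have hm0 : 0 < m := by linarith
  · have : 0 ≤ k + m - α := by linarith
    positivity
  · have rpow_eq : ∀ x : ℝ, 0 < x → x ^ (3 / 2 : ℝ) = x * √x := fun x hx => by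
      rw [show (3 / 2 : ℝ) = 1 + 1 / 2 by norm_num, Real.rpow_add hx, Real.rpow_one,
        Real.sqrt_eq_rpow]
    rw [rpow_eq k hk0, rpow_eq m hm0, div_mul_div_comm, one_mul]
    refine one_div_le_one_div_of_le (by positivity) ?_
    calc k * √k * (m * √m) = k * m * (√k * √m) := by ring
      _ ≤ k * m * (k + m - α) := by
        gcongr
        nlinarith [sq_nonneg (√k - √m), Real.sq_sqrt hk0.le, Real.sq_sqrt hm0.le]

theorem hasSum_pnat_pow_div_log {t : ℝ} (h : |t| < 1) :
    HasSum (fun n : ℕ+ => t ^ (n : ℕ) / ((n : ℕ) : ℝ)) (-Real.log (1 - t)) := by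
  have := Real.hasSum_pow_div_log_of_abs_lt_one h
  rw [← Equiv.pnatEquivNat.hasSum_iff] at this
  convert this using 2 with n
  have hn : ((Equiv.pnatEquivNat n : ℕ) : ℝ) + 1 = ((n : ℕ) : ℝ) := by
    exact_mod_cast PNat.natPred_add_one n
  simp only [Function.comp_apply, hn]
  rw [show Equiv.pnatEquivNat n + 1 = (n : ℕ) from PNat.natPred_add_one n]

theorem integral_Ioo_rpow {r : ℝ} (hr : -1 < r) :
    ∫ t in Set.Ioo (0 : ℝ) 1, t ^ r = 1 / (r + 1) := by
  rw [← integral_Ioc_eq_integral_Ioo, ← intervalIntegral.integral_of_le zero_le_one,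
    integral_rpow (Or.inl hr), Real.one_rpow, Real.zero_rpow (by linarith), sub_zero]

/-- Tornheim-type representation of the integral `I(α) = ∫₀¹ t^{-1-α} log²(1-t) dt`:
`I(α) = Σ_{k,m ≥ 1} 1/(k m (k+m-α))`, and the double series converges. -/
theorem stmt_17 (α : ℝ) (hα : α ∈ Set.Ioo (0 : ℝ) 1) :
    (∫ t in Set.Ioo (0 : ℝ) 1, t ^ (-1 - α) * (Real.log (1 - t)) ^ 2) =
      (∑' (k : ℕ+) (m : ℕ+),
        1 / (((k : ℕ) : ℝ) * ((m : ℕ) : ℝ) * (((k : ℕ) : ℝ) + ((m : ℕ) : ℝ) - α))) ∧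
    Summable (fun p : ℕ+ × ℕ+ =>
      1 / (((p.1 : ℕ) : ℝ) * ((p.2 : ℕ) : ℝ) *
        (((p.1 : ℕ) : ℝ) + ((p.2 : ℕ) : ℝ) - α))) := by
  have hsum := summable_tornheim hα.2.le
  refine ⟨?_, hsum⟩
  rw [← hsum.tsum_prod (f := fun p : ℕ+ × ℕ+ =>
      1 / (((p.1 : ℕ) : ℝ) * ((p.2 : ℕ) : ℝ) *
        (((p.1 : ℕ) : ℝ) + ((p.2 : ℕ) : ℝ) - α)))]
  let F : ℕ+ × ℕ+ → ℝ → ℝ := fun p t =>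
    1 / (((p.1 : ℕ) : ℝ) * ((p.2 : ℕ) : ℝ)) * t ^ (((p.1 : ℕ) : ℝ) + ((p.2 : ℕ) : ℝ) - 1 - α)
  have hexp (p : ℕ+ × ℕ+) : -1 < ((p.1 : ℕ) : ℝ) + ((p.2 : ℕ) : ℝ) - 1 - α := by
    have hk : (1 : ℝ) ≤ ((p.1 : ℕ) : ℝ) := by exact_mod_cast p.1.pos
    have hm : (1 : ℝ) ≤ ((p.2 : ℕ) : ℝ) := by exact_mod_cast p.2.pos
    linarith [hα.2]
  have hint (p : ℕ+ × ℕ+) : ∫ t in Set.Ioo (0 : ℝ) 1, F p t =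
      1 / (((p.1 : ℕ) : ℝ) * ((p.2 : ℕ) : ℝ) *
        (((p.1 : ℕ) : ℝ) + ((p.2 : ℕ) : ℝ) - α)) := by
    simp only [F]
    rw [integral_const_mul, integral_Ioo_rpow (hexp p), div_mul_div_comm, one_mul]
    congr 2
    ring
  have hF (p : ℕ+ × ℕ+) : Integrable (F p) (volume.restrict (Set.Ioo (0 : ℝ) 1)) :=
    (((intervalIntegral.intervalIntegrable_rpow' (hexp p)).1).mono_set
      Set.Ioo_subset_Ioc_self).const_mul _
  have hnorm (p : ℕ+ × ℕ+) :
      ∫ t in Set.Ioo (0 : ℝ) 1, ‖F p t‖ = ∫ t in Set.Ioo (0 : ℝ) 1, F p t :=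
    setIntegral_congr_fun measurableSet_Ioo fun t ht =>
      Real.norm_of_nonneg (mul_nonneg (by positivity) (Real.rpow_nonneg ht.1.le _))
  have key := hasSum_integral_of_summable_integral_norm hF (by simpa only [hnorm, hint] using hsum)
  simp only [hint] at key
  rw [key.tsum_eq]
  refine setIntegral_congr_fun measurableSet_Ioo fun t ht => ?_
  have hlog := hasSum_pnat_pow_div_log (abs_lt.2 ⟨by linarith [ht.1], ht.2⟩)
  have hnn (n : ℕ+) : 0 ≤ t ^ (n : ℕ) / ((n : ℕ) : ℝ) :=
    div_nonneg (pow_nonneg ht.1.le _) (Nat.cast_nonneg _)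
  have hprod := (hlog.mul hlog (hlog.summable.mul_of_nonneg hlog.summable hnn hnn)).mul_left
    (t ^ (-1 - α))
  have hterm (p : ℕ+ × ℕ+) : t ^ (-1 - α) *
      (t ^ (p.1 : ℕ) / ((p.1 : ℕ) : ℝ) * (t ^ (p.2 : ℕ) / ((p.2 : ℕ) : ℝ))) = F p t := by
    simp only [F]
    rw [show ((p.1 : ℕ) : ℝ) + ((p.2 : ℕ) : ℝ) - 1 - α = (-1 - α) + (p.1 : ℕ) + (p.2 : ℕ) by ring,
      Real.rpow_add_natCast ht.1.ne', Real.rpow_add_natCast ht.1.ne']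
    ring
  simp only [hterm] at hprod
  simp only [hprod.tsum_eq]
  ring
end
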